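/- arXiv:1603.05430 — 4 statements merged into one kernel-verified Lean document; each statement's English description precedes it below -/
import Mathlib

section
/- Let n, d ≥ 1 and let p = p(n,2d) be the Pythagoras number of n-ary forms of degree 2d. Then p is finite and satisfies the inequalities binom(p+1, 2) ≤ N_{n,2d} ≤ p·N_{n,d} − binom(p, 2), where N_{n,e} = binom(n+e−1, n−1). (Equivalently, for every f ∈ Σ_{n,2d} one has binom(ℓ(f)+1, 2) ≤ N_{n,2d}, and moreover N_{n,2d} ≤ p·N_{n,d} − binom(p, 2).) -/
open MvPolynomial

noncomputable section

/-- `f` is a sum of `r` squares of forms of degree `d` in `n` variables. -/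
def IsSOS (n d r : ℕ) (f : MvPolynomial (Fin n) ℝ) : Prop :=
  ∃ p : Fin r → MvPolynomial (Fin n) ℝ,
    (∀ i, (p i).IsHomogeneous d) ∧ f = ∑ i, p i ^ 2

/-- `f` lies in `Σ_{n,2d}`: it is a sum of squares of forms of degree `d`. -/
def InSigma (n d : ℕ) (f : MvPolynomial (Fin n) ℝ) : Prop :=
  ∃ r, IsSOS n d r f

/-- The sum of squares length `ℓ(f)`. -/
def sosLength (n d : ℕ) (f : MvPolynomial (Fin n) ℝ) : ℕ :=
  sInf {r | IsSOS n d r f}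

/-- The Pythagoras number `p(n,2d) = sup {ℓ(f) : f ∈ Σ_{n,2d}}`. -/
def pythagoras (n d : ℕ) : ℕ :=
  sSup {r | ∃ f, InSigma n d f ∧ sosLength n d f = r}

/-- Exponents of degree `e`. -/
def clrMon (n e : ℕ) : Finset (Fin n →₀ ℕ) := Finset.finsuppAntidiag Finset.univ e

theorem clr_mem_mon {n e : ℕ} {s : Fin n →₀ ℕ} : s ∈ clrMon n e ↔ s.degree = e := by
  simp [clrMon, Finset.mem_finsuppAntidiag, Finsupp.degree_eq_sum]

theorem clr_card_mon {n e : ℕ} (hn : 1 ≤ n) :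
    (clrMon n e).card = Nat.choose (n + e - 1) (n - 1) := by
  rw [clrMon, Finset.card_finsuppAntidiag_nat_eq_choose, Finset.card_univ, Fintype.card_fin]
  rw [← Nat.choose_symm_of_eq_add]
  omega

/-- The coefficient vector in degree `e`. -/
def clrCoords (n e : ℕ) : MvPolynomial (Fin n) ℝ →ₗ[ℝ] (clrMon n e → ℝ) :=
  LinearMap.pi fun m => MvPolynomial.lcoeff ℝ (m : Fin n →₀ ℕ)

theorem clrCoords_apply {n e : ℕ} (f : MvPolynomial (Fin n) ℝ) (m : clrMon n e) :
    clrCoords n e f m = coeff (m : Fin n →₀ ℕ) f := rfl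

theorem clrCoords_inj {n e : ℕ} {f : MvPolynomial (Fin n) ℝ} (hf : f.IsHomogeneous e)
    (h : clrCoords n e f = 0) : f = 0 := by
  ext m
  by_cases hm : m.degree = e
  · have := congrFun h ⟨m, clr_mem_mon.2 hm⟩
    simpa [clrCoords_apply] using this
  · simpa using hf.coeff_eq_zero hm

theorem clr_mono {n d r s : ℕ} {f : MvPolynomial (Fin n) ℝ} (hrs : r ≤ s)
    (h : IsSOS n d r f) : IsSOS n d s f := by
  obtain ⟨k, rfl⟩ := Nat.exists_eq_add_of_le hrs
  obtain ⟨p, hp, rfl⟩ := h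
  refine ⟨Fin.append p (fun _ => 0), fun i => ?_, ?_⟩
  · refine Fin.addCases (fun i => ?_) (fun i => ?_) i
    · simpa using hp i
    · simpa using isHomogeneous_zero _ _ _
  · simp [Fin.sum_univ_add]

theorem clr_add {n d : ℕ} {f g : MvPolynomial (Fin n) ℝ}
    (hf : InSigma n d f) (hg : InSigma n d g) : InSigma n d (f + g) := by
  obtain ⟨r, p, hp, rfl⟩ := hf
  obtain ⟨s, q, hq, rfl⟩ := hg
  refine ⟨r + s, Fin.append p q, fun i => ?_, ?_⟩
  · refine Fin.addCases (fun i => ?_) (fun i => ?_) i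
    · simpa using hp i
    · simpa using hq i
  · simp [Fin.sum_univ_add]

theorem clr_smul {n d : ℕ} {f : MvPolynomial (Fin n) ℝ} {a : ℝ} (ha : 0 ≤ a)
    (hf : InSigma n d f) : InSigma n d (a • f) := by
  obtain ⟨r, p, hp, rfl⟩ := hf
  refine ⟨r, fun i => C (Real.sqrt a) * p i, fun i => (hp i).C_mul _, ?_⟩
  rw [Finset.smul_sum]
  refine Finset.sum_congr rfl fun i _ => ?_
  rw [mul_pow, ← C_pow, Real.sq_sqrt ha, smul_eq_C_mul]

theorem clr_sq {n d : ℕ} {f : MvPolynomial (Fin n) ℝ} (hf : f.IsHomogeneous d) :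
    InSigma n d (f ^ 2) := ⟨1, fun _ => f, fun _ => hf, by simp⟩

theorem clr_zero {n d : ℕ} : InSigma n d 0 := ⟨0, Fin.elim0, fun i => i.elim0, by simp⟩

theorem clr_length {n d : ℕ} {f : MvPolynomial (Fin n) ℝ} (hf : InSigma n d f) :
    IsSOS n d (sosLength n d f) f := Nat.sInf_mem (s := {r | IsSOS n d r f}) hf

/-- Key reduction. -/
theorem clr_reduce {n d r : ℕ} (p : Fin r → MvPolynomial (Fin n) ℝ)
    (hp : ∀ i, (p i).IsHomogeneous d) (A : Matrix (Fin r) (Fin r) ℝ) (hA : A.IsHermitian)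
    (hA0 : A ≠ 0) (h : ∑ i, ∑ j, C (A i j) * (p i * p j) = 0) :
    ∃ s < r, IsSOS n d s (∑ i, p i ^ 2) := by
  set U : Matrix (Fin r) (Fin r) ℝ := (hA.eigenvectorUnitary).1 with hU
  set l := hA.eigenvalues with hl
  have hspec : ∀ i j, A i j = ∑ k, l k * (U i k * U j k) := by
    intro i j
    have := congrFun (congrFun hA.spectral_theorem i) j
    rw [Unitary.conjStarAlgAut_apply] at this
    rw [this, Matrix.mul_apply]
    refine Finset.sum_congr rfl fun k _ => ?_
    simp [Matrix.mul_diagonal, Matrix.star_apply, hU, hl]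
    ring
  have horth : ∀ i j, ∑ k, U i k * U j k = if i = j then 1 else 0 := by
    intro i j
    have h1 : U * star U = 1 := Unitary.coe_mul_star_self hA.eigenvectorUnitary
    have := congrFun (congrFun h1 i) j
    rw [Matrix.mul_apply, Matrix.one_apply] at this
    simpa [Matrix.star_apply] using this
  set q : Fin r → MvPolynomial (Fin n) ℝ := fun k => ∑ i, C (U i k) * p i with hq
  have hqh : ∀ k, (q k).IsHomogeneous d := fun k =>
    IsHomogeneous.sum _ _ _ fun i _ => (hp i).C_mul _
  have hgen : ∀ c : Fin r → ℝ, ∑ k, C (c k) * q k ^ 2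
      = ∑ i, ∑ j, C (∑ k, c k * (U i k * U j k)) * (p i * p j) := by
    intro c
    have : ∀ k, C (c k) * q k ^ 2
        = ∑ i, ∑ j, C (c k * (U i k * U j k)) * (p i * p j) := by
      intro k
      rw [hq, sq, Finset.sum_mul_sum, Finset.mul_sum]
      refine Finset.sum_congr rfl fun i _ => ?_
      rw [Finset.mul_sum]
      refine Finset.sum_congr rfl fun j _ => ?_
      simp only [C_mul]; ring
    simp_rw [this]
    rw [Finset.sum_comm]
    refine Finset.sum_congr rfl fun i _ => ?_
    rw [Finset.sum_comm]
    refine Finset.sum_congr rfl fun j _ => ?_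
    rw [map_sum, Finset.sum_mul]
  have h1 : ∑ k, q k ^ 2 = ∑ i, p i ^ 2 := by
    have := hgen (fun _ => 1)
    simp only [one_mul, C_1, horth] at this
    rw [this]
    refine Finset.sum_congr rfl fun i _ => ?_
    rw [Finset.sum_eq_single i]
    · simp [sq]
    · intro j _ hj; simp [hj.symm]
    · simp
  have h2 : ∑ k, C (l k) * q k ^ 2 = 0 := by
    rw [hgen]; simp only [← hspec]; exact h
  have hl0 : l ≠ 0 := fun h0 => hA0 (hA.eigenvalues_eq_zero_iff.1 h0)
  obtain ⟨k1, hk1⟩ := Function.ne_iff.1 hl0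
  obtain ⟨k0, -, hk0⟩ := Finset.exists_max_image Finset.univ (fun k => |l k|) ⟨k1, Finset.mem_univ _⟩
  have hk0ne : l k0 ≠ 0 := by
    have := hk0 k1 (Finset.mem_univ _)
    have h3 : 0 < |l k1| := abs_pos.2 hk1
    exact abs_pos.1 (h3.trans_le this)
  have hnn : ∀ k, 0 ≤ 1 - l k / l k0 := by
    intro k
    have : |l k / l k0| ≤ 1 := by
      rw [abs_div, div_le_one (abs_pos.2 hk0ne)]
      exact hk0 k (Finset.mem_univ _)
    linarith [le_abs_self (l k / l k0)]
  have h3 : ∑ i, p i ^ 2 = ∑ k, (C (Real.sqrt (1 - l k / l k0)) * q k) ^ 2 := by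
    have h4 : ∀ k, (C (Real.sqrt (1 - l k / l k0)) * q k) ^ 2
        = q k ^ 2 - C (1 / l k0) * (C (l k) * q k ^ 2) := by
      intro k
      rw [mul_pow, ← C_pow, Real.sq_sqrt (hnn k), ← mul_assoc, ← C_mul, C_sub, C_1, sub_mul, one_mul]
      congr 3
      ring_nf
    simp_rw [h4]
    rw [Finset.sum_sub_distrib, ← Finset.mul_sum, h2, h1]
    simp
  obtain ⟨s, rfl⟩ : ∃ s, r = s + 1 := ⟨r - 1, by have := k0.2; omega⟩
  refine ⟨s, Nat.lt_succ_self s, fun i => C (Real.sqrt (1 - l (k0.succAbove i) / l k0)) *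
    q (k0.succAbove i), fun i => (hqh _).C_mul _, ?_⟩
  rw [h3, Fin.sum_univ_succAbove _ k0]
  simp [div_self hk0ne]

theorem clr_indep {n d : ℕ} {f : MvPolynomial (Fin n) ℝ} (hf : InSigma n d f)
    (p : Fin (sosLength n d f) → MvPolynomial (Fin n) ℝ)
    (hp : ∀ i, (p i).IsHomogeneous d) (hfp : f = ∑ i, p i ^ 2)
    (A : Matrix (Fin (sosLength n d f)) (Fin (sosLength n d f)) ℝ) (hA : A.IsHermitian)
    (h : ∑ i, ∑ j, C (A i j) * (p i * p j) = 0) : A = 0 := by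
  by_contra hA0
  obtain ⟨s, hs, h'⟩ := clr_reduce p hp A hA hA0 h
  rw [← hfp] at h'
  exact absurd (Nat.sInf_le (s := {r | IsSOS n d r f}) h') (not_le.2 hs)

theorem clr_upper {n d : ℕ} (hn : 1 ≤ n) {f : MvPolynomial (Fin n) ℝ} (hf : InSigma n d f) :
    Nat.choose (sosLength n d f + 1) 2 ≤ Nat.choose (n + 2 * d - 1) (n - 1) := by
  obtain ⟨p, hp, hfp⟩ := clr_length hf
  rw [← clr_card_mon hn]
  by_contra! hlt
  let Φ : (Sym2 (Fin (sosLength n d f)) → ℝ) →ₗ[ℝ] MvPolynomial (Fin n) ℝ :=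
    ∑ i, ∑ j, (LinearMap.toSpanSingleton ℝ _ (p i * p j)) ∘ₗ (LinearMap.proj s(i, j))
  have hΦ : ∀ g, Φ g = ∑ i, ∑ j, C (g s(i, j)) * (p i * p j) := by
    intro g
    simp [Φ, LinearMap.sum_apply, smul_eq_C_mul]
  have hker : LinearMap.ker (clrCoords n (2 * d) ∘ₗ Φ) ≠ ⊥ := by
    apply LinearMap.ker_ne_bot_of_finrank_lt
    rw [Module.finrank_fintype_fun_eq_card, Module.finrank_fintype_fun_eq_card, Sym2.card]
    simpa using hlt
  obtain ⟨g, hg, hg0⟩ := Submodule.exists_mem_ne_zero_of_ne_bot hker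
  have hh : (Φ g).IsHomogeneous (2 * d) := by
    rw [hΦ, two_mul]
    exact IsHomogeneous.sum _ _ _ fun i _ => IsHomogeneous.sum _ _ _ fun j _ =>
      ((hp i).mul (hp j)).C_mul _
  have h0 : Φ g = 0 := clrCoords_inj hh (by simpa using hg)
  have hA := clr_indep hf p hp hfp (Matrix.of fun i j => g s(i, j))
    (by ext i j; simp [Sym2.eq_swap]) (by rw [hΦ] at h0; simpa using h0)
  apply hg0
  ext s
  induction s using Sym2.ind with
  | _ i j => simpa using congrFun (congrFun hA i) j

theorem clr_upper' {n d : ℕ} {f : MvPolynomial (Fin n) ℝ} (hf : InSigma n d f) :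
    sosLength n d f ≤ (clrMon n d).card := by
  obtain ⟨p, hp, hfp⟩ := clr_length hf
  by_contra! hlt
  let Φ : (Fin (sosLength n d f) → ℝ) →ₗ[ℝ] MvPolynomial (Fin n) ℝ :=
    ∑ i, (LinearMap.toSpanSingleton ℝ _ (p i)) ∘ₗ (LinearMap.proj i)
  have hΦ : ∀ g, Φ g = ∑ i, C (g i) * p i := by
    intro g
    simp [Φ, LinearMap.sum_apply, smul_eq_C_mul]
  have hker : LinearMap.ker (clrCoords n d ∘ₗ Φ) ≠ ⊥ := by
    apply LinearMap.ker_ne_bot_of_finrank_lt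
    rw [Module.finrank_fintype_fun_eq_card, Module.finrank_fintype_fun_eq_card]
    simpa using hlt
  obtain ⟨g, hg, hg0⟩ := Submodule.exists_mem_ne_zero_of_ne_bot hker
  have hh : (Φ g).IsHomogeneous d := by
    rw [hΦ]
    exact IsHomogeneous.sum _ _ _ fun i _ => (hp i).C_mul _
  have h0 : Φ g = 0 := clrCoords_inj hh (by simpa using hg)
  have hA := clr_indep hf p hp hfp (Matrix.of fun i j => g i * g j)
    (by ext i j; simp [mul_comm]) (by
      have : (Φ g) * (Φ g) = 0 := by rw [h0, zero_mul]
      rw [hΦ, Finset.sum_mul_sum] at this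
      rw [← this]
      refine Finset.sum_congr rfl fun i _ => Finset.sum_congr rfl fun j _ => ?_
      simp only [Matrix.of_apply, C_mul]; ring)
  apply hg0
  ext i
  simpa using congrFun (congrFun hA i) i

theorem clr_split {n : ℕ} (d e : ℕ) : ∀ s : Fin n →₀ ℕ, s.degree = d + e →
    ∃ a b : Fin n →₀ ℕ, a.degree = d ∧ b.degree = e ∧ a + b = s := by
  induction d with
  | zero => intro s hs; exact ⟨0, s, by simp, by simpa using hs, by simp⟩
  | succ d ih =>
    intro s hs
    have hs0 : s ≠ 0 := by rintro rfl; simp at hs; omega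
    obtain ⟨i, hi⟩ := Finsupp.ne_iff.1 hs0
    have hle : Finsupp.single i 1 ≤ s := by
      rw [Finsupp.single_le_iff]; exact Nat.one_le_iff_ne_zero.2 hi
    obtain ⟨t, rfl⟩ := exists_add_of_le hle
    obtain ⟨a, b, ha, hb, rfl⟩ := ih t (by simp at hs; omega)
    exact ⟨Finsupp.single i 1 + a, b, by simp [ha, add_comm], hb, by rw [add_assoc]⟩

/-- The cone of coefficient vectors of sums of squares. -/
def clrCone (n d : ℕ) : Set (clrMon n (2 * d) → ℝ) :=
  {c | ∃ f, InSigma n d f ∧ clrCoords n (2 * d) f = c}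

theorem clr_interior (n d : ℕ) : (interior (clrCone n d)).Nonempty := by
  have hconv : Convex ℝ (clrCone n d) := by
    rintro _ ⟨f, hf, rfl⟩ _ ⟨g, hg, rfl⟩ a b ha hb -
    exact ⟨a • f + b • g, clr_add (clr_smul ha hf) (clr_smul hb hg), by simp⟩
  have h0 : (0 : clrMon n (2 * d) → ℝ) ∈ clrCone n d := ⟨0, clr_zero, by simp⟩
  rw [hconv.interior_nonempty_iff_affineSpan_eq_top,
    AffineSubspace.affineSpan_eq_top_iff_vectorSpan_eq_top_of_nonempty _ _ _ ⟨0, h0⟩,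
    vectorSpan_eq_span_vsub_set_right ℝ h0]
  simp only [vsub_eq_sub, sub_zero, Set.image_id']
  rw [eq_top_iff, ← (Pi.basisFun ℝ (clrMon n (2 * d))).span_eq, Submodule.span_le]
  rintro _ ⟨m, rfl⟩
  obtain ⟨a, b, ha, hb, hab⟩ := clr_split d d (m : Fin n →₀ ℕ)
    (by rw [clr_mem_mon.1 m.2, two_mul])
  have hah : (monomial a (1 : ℝ)).IsHomogeneous d := isHomogeneous_monomial _ ha
  have hbh : (monomial b (1 : ℝ)).IsHomogeneous d := isHomogeneous_monomial _ hb
  have key : ∀ {f}, InSigma n d f →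
      clrCoords n (2 * d) f ∈ Submodule.span ℝ (clrCone n d) :=
    fun hf => Submodule.subset_span ⟨_, hf, rfl⟩
  have hmem := Submodule.smul_mem _ (1 / 2 : ℝ) (Submodule.sub_mem _ (Submodule.sub_mem _
    (key (clr_sq (hah.add hbh))) (key (clr_sq hah))) (key (clr_sq hbh)))
  rw [← map_sub, ← map_sub, ← map_smul] at hmem
  have he : (1 / 2 : ℝ) • ((monomial a (1 : ℝ) + monomial b 1) ^ 2 - monomial a 1 ^ 2
      - monomial b 1 ^ 2) = monomial (m : Fin n →₀ ℕ) (1 : ℝ) := by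
    rw [show (monomial a (1 : ℝ) + monomial b 1) ^ 2 - monomial a 1 ^ 2
      - monomial b 1 ^ 2 = C 2 * (monomial a (1 : ℝ) * monomial b 1) by
        rw [show (C 2 : MvPolynomial (Fin n) ℝ) = 2 from map_ofNat C 2]; ring,
      smul_eq_C_mul, ← mul_assoc, ← C_mul, monomial_mul, hab]
    norm_num
  rw [he] at hmem
  have hb : (Pi.basisFun ℝ (clrMon n (2 * d))) m
      = clrCoords n (2 * d) (monomial (m : Fin n →₀ ℕ) (1 : ℝ)) := ?_
  · rw [hb]; exact hmem
  ext m'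
  rw [clrCoords_apply, coeff_monomial]
  rw [Pi.basisFun_apply, Pi.single_apply]
  by_cases hm : m' = m
  · subst hm; simp
  · rw [if_neg hm, if_neg fun h' => hm (Subtype.ext h'.symm)]

/-- Index set of upper triangular matrices. -/
abbrev clrTri (r N : ℕ) : Type := {x : Fin r × Fin N // (x.1 : ℕ) ≤ x.2}

theorem clr_card_tri {r N : ℕ} (h : r ≤ N) :
    Fintype.card (clrTri r N) + r.choose 2 = r * N := by
  have h1 : Fintype.card {x : Fin r × Fin N // ¬ (x.1 : ℕ) ≤ x.2} = r.choose 2 := by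
    have e : {x : Fin r × Fin N // ¬ (x.1 : ℕ) ≤ x.2} ≃ Σ i : Fin r, Fin i :=
      { toFun := fun x => ⟨x.1.1, ⟨x.1.2, not_le.1 x.2⟩⟩
        invFun := fun y => ⟨(y.1, ⟨y.2, by have := y.1.2; have := y.2.2; omega⟩),
          by simp⟩
        left_inv := fun x => rfl
        right_inv := fun x => rfl }
    rw [Fintype.card_congr e, Fintype.card_sigma]
    simp only [Fintype.card_fin]
    rw [Fin.sum_univ_eq_sum_range (fun i => i), Finset.sum_range_id, Nat.choose_two_right]
  rw [← h1, Fintype.card_subtype_compl]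
  have := Fintype.card_subtype_le (fun x : Fin r × Fin N => (x.1 : ℕ) ≤ x.2)
  rw [Fintype.card_prod, Fintype.card_fin, Fintype.card_fin] at *
  exact Nat.add_sub_of_le this

theorem clr_triang {r N : ℕ} (h : r ≤ N) (v : Fin r → Fin N → ℝ) :
    ∃ w : Fin r → Fin N → ℝ, (∀ (i : Fin r) (j : Fin N), (j : ℕ) < i → w i j = 0) ∧
      ∀ j k, ∑ i, w i j * w i k = ∑ i, v i j * v i k := by
  let col : Fin N → EuclideanSpace ℝ (Fin r) := fun j => WithLp.toLp 2 fun i => v i j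
  let b := InnerProductSpace.gramSchmidtOrthonormalBasis (𝕜 := ℝ)
    (E := EuclideanSpace ℝ (Fin r)) (ι := Fin r) (by simp) (fun i => col (Fin.castLE h i))
  refine ⟨fun i j => inner ℝ (b i) (col j), fun i j hij => ?_, fun j k => ?_⟩
  · have := InnerProductSpace.gramSchmidtOrthonormalBasis_inv_triangular (𝕜 := ℝ)
      (E := EuclideanSpace ℝ (Fin r)) (ι := Fin r) (by simp) (fun i => col (Fin.castLE h i))
      (i := ⟨j, hij.trans i.2⟩) (j := i) hij
    exact this
  · have := b.sum_inner_mul_inner (col j) (col k)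
    simp_rw [real_inner_comm (b _) (col j)] at this ⊢
    rw [this]
    simp [col, PiLp.inner_apply, mul_comm]

/-- The triangular sum of squares map. -/
def clrF (n d r N : ℕ) (e : Fin N ≃ clrMon n d) (a : clrTri r N → ℝ) :
    clrMon n (2 * d) → ℝ := fun m =>
  ∑ i : Fin r, ∑ j : Fin N, ∑ k : Fin N,
    ((if h : (i : ℕ) ≤ j then a ⟨(i, j), h⟩ else 0) *
      (if h : (i : ℕ) ≤ k then a ⟨(i, k), h⟩ else 0)) *
      (if ((e j : Fin n →₀ ℕ) + e k) = m then 1 else 0)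

theorem clrF_contDiff (n d r N : ℕ) (e : Fin N ≃ clrMon n d) :
    ContDiff ℝ 1 (clrF n d r N e) := by
  rw [contDiff_pi]
  intro m
  unfold clrF
  refine ContDiff.sum fun i _ => ContDiff.sum fun j _ => ContDiff.sum fun k _ => ?_
  refine ContDiff.mul (ContDiff.mul ?_ ?_) contDiff_const
  · split_ifs
    · exact contDiff_apply ℝ ℝ _
    · exact contDiff_const
  · split_ifs
    · exact contDiff_apply ℝ ℝ _
    · exact contDiff_const

theorem clr_expand {n d N : ℕ} (e : Fin N ≃ clrMon n d) {p : MvPolynomial (Fin n) ℝ}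
    (hp : p.IsHomogeneous d) : p = ∑ j, monomial (e j : Fin n →₀ ℕ) (coeff (e j) p) := by
  rw [e.sum_comp (fun m => monomial (m : Fin n →₀ ℕ) (coeff (m : Fin n →₀ ℕ) p)),
    Finset.sum_coe_sort (clrMon n d) (fun m => monomial m (coeff m p))]
  ext m
  rw [coeff_sum]
  simp only [coeff_monomial]
  rw [Finset.sum_ite_eq']
  split_ifs with h
  · rfl
  · exact hp.coeff_eq_zero fun h' => h (clr_mem_mon.2 h')

theorem clr_range {n d r N : ℕ} (e : Fin N ≃ clrMon n d) (h : r ≤ N)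
    {f : MvPolynomial (Fin n) ℝ} (hf : IsSOS n d r f) :
    clrCoords n (2 * d) f ∈ Set.range (clrF n d r N e) := by
  obtain ⟨p, hp, rfl⟩ := hf
  obtain ⟨w, hw0, hw⟩ := clr_triang h (fun i j => coeff (e j : Fin n →₀ ℕ) (p i))
  refine ⟨fun x => w x.1.1 x.1.2, ?_⟩
  ext m
  have hwi : ∀ (i : Fin r) (j : Fin N), (if h : (i : ℕ) ≤ (j : ℕ) then w i j else 0) = w i j := by
    intro i j
    split_ifs with hij
    · rfl
    · exact (hw0 i j (not_le.1 hij)).symm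
  have hgen : ∀ u : Fin r → Fin N → ℝ, (∑ i, ∑ j, ∑ k, (u i j * u i k) *
      (if ((e j : Fin n →₀ ℕ) + e k) = m then (1 : ℝ) else 0)) =
      ∑ j, ∑ k, (∑ i, u i j * u i k) *
        (if ((e j : Fin n →₀ ℕ) + e k) = m then (1 : ℝ) else 0) := by
    intro u
    rw [Finset.sum_comm]
    refine Finset.sum_congr rfl fun j _ => ?_
    rw [Finset.sum_comm]
    refine Finset.sum_congr rfl fun k _ => ?_
    rw [Finset.sum_mul]
  simp only [clrF, hwi]
  rw [hgen, clrCoords_apply, coeff_sum]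
  simp_rw [hw]
  rw [← hgen]
  refine Finset.sum_congr rfl fun i _ => ?_
  conv_rhs => rw [clr_expand e (hp i), sq, Finset.sum_mul_sum, coeff_sum]
  refine Finset.sum_congr rfl fun j _ => ?_
  rw [coeff_sum]
  refine Finset.sum_congr rfl fun k _ => ?_
  rw [monomial_mul, coeff_monomial]
  simp

theorem clr_lower {n d r : ℕ} (h : r ≤ (clrMon n d).card)
    (hall : ∀ f, InSigma n d f → IsSOS n d r f) :
    (clrMon n (2 * d)).card + r.choose 2 ≤ r * (clrMon n d).card := by
  rw [← clr_card_tri h]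
  by_contra! hlt
  let e := (clrMon n d).equivFin.symm
  have hd := (clrF_contDiff n d r _ e).dense_compl_range_of_finrank_lt_finrank (by
    rw [Module.finrank_fintype_fun_eq_card, Module.finrank_fintype_fun_eq_card]
    simpa using hlt)
  obtain ⟨c, hc, hc'⟩ := hd.inter_open_nonempty _ isOpen_interior (clr_interior n d)
  obtain ⟨f, hf, rfl⟩ := interior_subset hc
  exact hc' (clr_range e h (hall f hf))

/-- Choi–Lam–Reznick bounds: the Pythagoras number `p = p(n,2d)` is finite and
satisfies `binom(p+1,2) ≤ N_{n,2d}` and `N_{n,2d} ≤ p·N_{n,d} − binom(p,2)`,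
where `N_{n,e} = binom(n+e-1, n-1)`; moreover `binom(ℓ(f)+1,2) ≤ N_{n,2d}`
for every `f ∈ Σ_{n,2d}`. -/
theorem clr_bounds (n d : ℕ) (hn : 1 ≤ n) (hd : 1 ≤ d) :
    BddAbove {r : ℕ | ∃ f, InSigma n d f ∧ sosLength n d f = r} ∧
    Nat.choose (pythagoras n d + 1) 2 ≤ Nat.choose (n + 2 * d - 1) (n - 1) ∧
    Nat.choose (n + 2 * d - 1) (n - 1) + Nat.choose (pythagoras n d) 2 ≤
      pythagoras n d * Nat.choose (n + d - 1) (n - 1) ∧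
    ∀ f, InSigma n d f →
      Nat.choose (sosLength n d f + 1) 2 ≤ Nat.choose (n + 2 * d - 1) (n - 1) := by
  have hbdd : BddAbove {r : ℕ | ∃ f, InSigma n d f ∧ sosLength n d f = r} := by
    refine ⟨(clrMon n d).card, ?_⟩
    rintro _ ⟨f, hf, rfl⟩
    exact clr_upper' hf
  have hmem : pythagoras n d ∈ {r : ℕ | ∃ f, InSigma n d f ∧ sosLength n d f = r} :=
    Nat.sSup_mem ⟨_, 0, clr_zero, rfl⟩ hbdd
  obtain ⟨f0, hf0, hlen⟩ := hmem
  refine ⟨hbdd, ?_, ?_, fun f hf => clr_upper hn hf⟩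
  · rw [← hlen]
    exact clr_upper hn hf0
  · rw [← clr_card_mon hn, ← clr_card_mon hn]
    refine clr_lower ?_ fun f hf => ?_
    · rw [← hlen]
      exact clr_upper' hf0
    · exact clr_mono (le_csSup hbdd ⟨f, hf, rfl⟩) (clr_length hf)
end
end

section
/- Let r ≥ 1. For any finite collection l_1, …, l_N of linear forms in ℝ[t][x_1, …, x_r] (polynomials homogeneous of degree 1 in x_1,…,x_r with coefficients in the polynomial ring ℝ[t]), there exist r+1 linear forms l'_1, …, l'_{r+1} in ℝ[t][x_1, …, x_r] with l_1² + ⋯ + l_N² = l'_1² + ⋯ + l'_{r+1}². Moreover r+1 is optimal: there exists a finite collection of linear forms in ℝ[t][x_1,…,x_r] whose sum of squares is not a sum of r squares of linear forms. -/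
namespace LeepProof

open Polynomial Matrix

variable {ι : Type} [Fintype ι] [DecidableEq ι]

/-- Pointwise positive semidefinite polynomial matrices. -/
def PSD (G : Matrix ι ι ℝ[X]) : Prop :=
  ∀ v : ι → ℝ[X], ∀ t : ℝ, 0 ≤ (v ⬝ᵥ G *ᵥ v).eval t

lemma lc_nonneg (f : ℝ[X]) (h : ∀ t, 0 ≤ f.eval t) : 0 ≤ f.leadingCoeff := by
  by_contra hlt
  push Not at hlt
  rcases lt_or_ge 0 f.degree with hd | hd
  · have h1 := f.tendsto_atBot_of_leadingCoeff_nonpos hd hlt.le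
    obtain ⟨t, ht⟩ := (h1.eventually (Filter.eventually_lt_atBot 0)).exists
    exact absurd (h t) (not_le.mpr ht)
  · have := Polynomial.eq_C_of_degree_le_zero hd
    rw [this] at h hlt
    have h0 := h 0
    simp at h0 hlt
    linarith

lemma natDegree_le_of_sq_le (f h : ℝ[X]) (k : ℕ) (hk : h.natDegree ≤ 2 * k)
    (hf : ∀ t, (f.eval t) ^ 2 ≤ h.eval t) : f.natDegree ≤ k := by
  by_contra hlt
  push Not at hlt
  have hf0 : f ≠ 0 := by rintro rfl; simp at hlt
  have hd : h.degree < (f ^ 2).degree := by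
    apply Polynomial.degree_lt_degree
    rw [Polynomial.natDegree_pow]; omega
  have h1 := lc_nonneg (h - f ^ 2) (fun t => by simpa using hf t)
  rw [sub_eq_add_neg, Polynomial.leadingCoeff_add_of_degree_lt (by rwa [Polynomial.degree_neg]),
    Polynomial.leadingCoeff_neg, Polynomial.leadingCoeff_pow] at h1
  have : 0 < f.leadingCoeff ^ 2 := by
    have := Polynomial.leadingCoeff_ne_zero.mpr hf0
    positivity
  linarith

lemma natDegree_even (f : ℝ[X]) (h : ∀ t, 0 ≤ f.eval t) : Even f.natDegree := by
  by_contra hodd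
  rw [Nat.not_even_iff_odd] at hodd
  have hf0 : f ≠ 0 := by rintro rfl; simp at hodd
  have h1 := lc_nonneg f h
  have h2 := lc_nonneg (f.comp (-X)) (fun t => by simpa using h (-t))
  rw [Polynomial.leadingCoeff_comp (by simp)] at h2
  simp [hodd.neg_one_pow] at h2
  exact hf0 (Polynomial.leadingCoeff_eq_zero.mp (le_antisymm h2 h1))

lemma nonneg_of_sq_mul (p f : ℝ[X]) (hp : p ≠ 0) (h : ∀ t, 0 ≤ (p ^ 2 * f).eval t) (t : ℝ) :
    0 ≤ f.eval t := by
  by_contra hlt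
  push Not at hlt
  have hopen : IsOpen {s : ℝ | f.eval s < 0} := isOpen_lt f.continuous continuous_const
  have hinf : {s : ℝ | f.eval s < 0}.Infinite := infinite_of_mem_nhds t (hopen.mem_nhds hlt)
  apply hp
  apply Polynomial.eq_zero_of_infinite_isRoot
  refine hinf.mono ?_
  intro s hs
  have h1 := h s
  simp only [Set.mem_ofPred_eq, Polynomial.eval_mul, Polynomial.eval_pow, Polynomial.IsRoot] at *
  by_contra hne
  have : 0 < (p.eval s) ^ 2 := by positivity
  nlinarith

lemma symm_dot {G : Matrix ι ι ℝ[X]} (hs : Gᵀ = G) (u v : ι → ℝ[X]) :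
    u ⬝ᵥ G *ᵥ v = v ⬝ᵥ G *ᵥ u := by
  rw [Matrix.dotProduct_mulVec, ← Matrix.mulVec_transpose, hs, dotProduct_comm]

lemma PSD.cauchy {G : Matrix ι ι ℝ[X]} (hG : PSD G) (hs : Gᵀ = G) (u v : ι → ℝ[X]) (t : ℝ) :
    ((u ⬝ᵥ G *ᵥ v).eval t) ^ 2 ≤ ((u ⬝ᵥ G *ᵥ u) * (v ⬝ᵥ G *ᵥ v)).eval t := by
  have key : ∀ x : ℝ, 0 ≤ (v ⬝ᵥ G *ᵥ v).eval t * (x * x) + (2 * (u ⬝ᵥ G *ᵥ v).eval t) * x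
      + (u ⬝ᵥ G *ᵥ u).eval t := by
    intro x
    have := hG (u + (Polynomial.C x) • v) t
    rw [Matrix.mulVec_add, Matrix.mulVec_smul, dotProduct_add, add_dotProduct, add_dotProduct,
      smul_dotProduct, dotProduct_smul, smul_dotProduct, dotProduct_smul, symm_dot hs v u] at this
    simp only [Polynomial.eval_add, smul_eq_mul, Polynomial.eval_mul, Polynomial.eval_C] at this
    linarith
  have := discrim_le_zero key
  rw [discrim] at this
  rw [Polynomial.eval_mul]
  nlinarith

lemma PSD.mulVec_eq_zero {G : Matrix ι ι ℝ[X]} (hG : PSD G) (hs : Gᵀ = G) (v : ι → ℝ[X])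
    (hv : v ⬝ᵥ G *ᵥ v = 0) : G *ᵥ v = 0 := by
  funext i
  have h := hG.cauchy hs (Pi.single i 1) v
  rw [hv] at h
  simp only [single_dotProduct, one_mul, mul_zero, Polynomial.eval_zero] at h
  apply Polynomial.funext
  intro t
  have := h t
  simp only [Pi.zero_apply, Polynomial.eval_zero]
  nlinarith [sq_nonneg (((G *ᵥ v) i).eval t)]

/-- The basic lattice step. -/
lemma descent {G : Matrix ι ι ℝ[X]} (hG : PSD G) (hs : Gᵀ = G) (p : ℝ[X]) (hp : p ≠ 0)
    (v : ι → ℝ[X]) (i : ι) (hvi : v i = 1) (h1 : ∀ k, p ∣ (G *ᵥ v) k)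
    (h2 : p ^ 2 ∣ v ⬝ᵥ G *ᵥ v) :
    ∃ T G' : Matrix ι ι ℝ[X], G = Tᵀ * G' * T ∧ T.det = p ∧ PSD G' ∧ G'ᵀ = G' ∧
      p ^ 2 * G' i i = v ⬝ᵥ G *ᵥ v ∧ ∀ k, k ≠ i → G' k k = G k k := by
  set w : ι → ℝ[X] := p • Pi.single i 1 - v with hw
  set R : Matrix ι ι ℝ[X] := vecMulVec w (Pi.single i 1) with hR
  set E : Matrix ι ι ℝ[X] := p • (1 : Matrix ι ι ℝ[X]) - R with hE
  set T : Matrix ι ι ℝ[X] := 1 + R with hT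
  have hTdet : T.det = p := by
    rw [hT, hR, Matrix.vecMulVec_eq Unit, Matrix.det_one_add_replicateCol_mul_replicateRow]
    simp [hvi, hw]
  have hRR : R * R = (p - 1) • R := by
    rw [hR, Matrix.vecMulVec_mul_vecMulVec]
    ext k l : 2
    simp [hw, hvi, Matrix.vecMulVec_apply]
    ring_nf
  have hET : E * T = p • 1 := by
    rw [hE, hT, Matrix.sub_mul, Matrix.mul_add, Matrix.mul_add, hRR, sub_smul]
    simp
  have hEi : E *ᵥ Pi.single i 1 = v := by
    ext k : 1
    simp [hE, hR, hw, Matrix.vecMulVec_apply, Matrix.one_apply, Pi.single_apply]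
  have hEk : ∀ k, k ≠ i → E *ᵥ Pi.single k 1 = p • Pi.single k 1 := by
    intro k hk; ext l : 1
    simp [hE, hR, hk, Matrix.vecMulVec_apply, Matrix.one_apply, Pi.single_apply]
  have hent : ∀ k l, (Eᵀ * G * E) k l = (E *ᵥ Pi.single k 1) ⬝ᵥ G *ᵥ (E *ᵥ Pi.single l 1) := by
    intro k l
    rw [Matrix.mulVec_mulVec, Matrix.mulVec_single_one, Matrix.mulVec_single_one, Matrix.mul_assoc]
    rfl
  have hdiv : ∀ k l, p ^ 2 ∣ (Eᵀ * G * E) k l := by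
    intro k l
    rw [hent]
    by_cases hk : k = i
    · by_cases hl : l = i
      · subst hk; subst hl; rw [hEi]; exact h2
      · subst hk
        rw [hEi, hEk l hl, symm_dot hs, smul_dotProduct, smul_eq_mul, pow_two]
        apply mul_dvd_mul_left
        simpa using h1 l
    · by_cases hl : l = i
      · subst hl
        rw [hEi, hEk k hk, smul_dotProduct, smul_eq_mul, pow_two]
        apply mul_dvd_mul_left
        simpa using h1 k
      · rw [hEk k hk, hEk l hl, smul_dotProduct, Matrix.mulVec_smul, dotProduct_smul, smul_eq_mul,
          smul_eq_mul, ← mul_assoc, pow_two]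
        exact dvd_mul_right _ _
  choose G' hG' using hdiv
  have hp2 : p ^ 2 ≠ 0 := pow_ne_zero _ hp
  have hGE : (p ^ 2) • (Matrix.of G') = Eᵀ * G * E := by
    ext k l : 2
    rw [hG' k l]; rfl
  refine ⟨T, Matrix.of G', ?_, hTdet, ?_, ?_, ?_, ?_⟩
  · have : (p ^ 2) • G = (p ^ 2) • (Tᵀ * Matrix.of G' * T) := by
      rw [← Matrix.smul_mul, ← Matrix.mul_smul, hGE]
      have : Tᵀ * (Eᵀ * G * E) * T = (E * T)ᵀ * G * (E * T) := by
        rw [Matrix.transpose_mul]; simp only [Matrix.mul_assoc]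
      rw [this, hET]
      simp [smul_smul, pow_two]
    exact smul_right_injective _ hp2 this
  · intro u t
    refine nonneg_of_sq_mul p _ hp (fun t => ?_) t
    have := hG (E *ᵥ u) t
    have h3 : (E *ᵥ u) ⬝ᵥ G *ᵥ (E *ᵥ u) = p ^ 2 * (u ⬝ᵥ Matrix.of G' *ᵥ u) := by
      rw [← smul_eq_mul, ← dotProduct_smul, ← Matrix.smul_mulVec, hGE, ← Matrix.mulVec_mulVec,
        ← Matrix.mulVec_mulVec, Matrix.dotProduct_mulVec u, Matrix.vecMul_transpose]
    rwa [h3] at this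
  · apply smul_right_injective _ hp2
    change (p ^ 2) • (Matrix.of G')ᵀ = (p ^ 2) • (Matrix.of G')
    rw [← Matrix.transpose_smul, hGE]
    simp [Matrix.transpose_mul, hs, Matrix.mul_assoc]
  · rw [Matrix.of_apply, ← hG', hent, hEi]
  · intro k hk
    apply mul_left_cancel₀ hp2
    rw [Matrix.of_apply, ← hG', hent, hEk k hk, smul_dotProduct, Matrix.mulVec_smul, dotProduct_smul,
      smul_eq_mul, smul_eq_mul, ← mul_assoc, pow_two]
    simp

lemma natDegree_prod_le' {κ : Type} (s : Finset κ) (f : κ → ℝ[X]) (d : κ → ℕ)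
    (h : ∀ k ∈ s, (f k).natDegree ≤ d k) : (∏ k ∈ s, f k).natDegree ≤ ∑ k ∈ s, d k :=
  (Polynomial.natDegree_prod_le s f).trans (Finset.sum_le_sum h)

lemma coeff_prod' {κ : Type} [DecidableEq κ] (s : Finset κ) (f : κ → ℝ[X]) (d : κ → ℕ)
    (h : ∀ k ∈ s, (f k).natDegree ≤ d k) :
    (∏ k ∈ s, f k).coeff (∑ k ∈ s, d k) = ∏ k ∈ s, (f k).coeff (d k) := by
  induction s using Finset.induction_on with
  | empty => simp
  | insert a s ha ih =>
    rw [Finset.prod_insert ha, Finset.sum_insert ha, Finset.prod_insert ha,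
      Polynomial.coeff_mul_add_eq_of_natDegree_le (h a (by simp))
        (natDegree_prod_le' s f d (fun k hk => h k (by simp [hk]))),
      ih (fun k hk => h k (by simp [hk]))]

lemma coeff_det (G : Matrix ι ι ℝ[X]) (m : ι → ℕ) (h : ∀ i j, (G i j).natDegree ≤ m i + m j) :
    G.det.coeff (2 * ∑ i, m i) = (Matrix.of fun i j => (G i j).coeff (m i + m j)).det := by
  rw [Matrix.det_apply, Matrix.det_apply, Polynomial.finsetSum_coeff]
  refine Finset.sum_congr rfl fun σ _ => ?_
  have hsum : 2 * ∑ i, m i = ∑ i, (m (σ i) + m i) := by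
    rw [Finset.sum_add_distrib, Equiv.sum_comp σ m]; ring
  have := coeff_prod' Finset.univ (fun i => G (σ i) i) (fun i => m (σ i) + m i) (fun i _ => h _ _)
  rw [← hsum] at this
  rw [show (Equiv.Perm.sign σ • ∏ i, G (σ i) i).coeff (2 * ∑ i, m i)
    = Equiv.Perm.sign σ • (∏ i, G (σ i) i).coeff (2 * ∑ i, m i) from
      Polynomial.coeff_smul _ _ _, this]
  rfl

lemma real_factor (L : Matrix ι ι ℝ) (hL : L.PosSemidef) : ∃ B : Matrix ι ι ℝ, L = Bᵀ * B := by
  open scoped MatrixOrder in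
  obtain ⟨B, hB⟩ := CStarAlgebra.nonneg_iff_eq_star_mul_self.mp hL.nonneg
  exact ⟨B, hB⟩

lemma PSD.natDegree_le {G : Matrix ι ι ℝ[X]} (hG : PSD G) (hs : Gᵀ = G) (m : ι → ℕ)
    (hm : ∀ i, (G i i).natDegree ≤ 2 * m i) (i j : ι) : (G i j).natDegree ≤ m i + m j := by
  refine natDegree_le_of_sq_le (G i j) (G i i * G j j) (m i + m j) ?_ ?_
  · refine Polynomial.natDegree_mul_le.trans ?_
    have := hm i; have := hm j; omega
  · intro t
    simpa using hG.cauchy hs (Pi.single i 1) (Pi.single j 1) t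

lemma stepB (N : ℕ) : ∀ (G : Matrix ι ι ℝ[X]) (m : ι → ℕ) (d : ℝ), PSD G → Gᵀ = G →
    G.det = Polynomial.C d → d ≠ 0 → (∀ i, (G i i).natDegree ≤ 2 * m i) → ∑ i, m i = N →
    ∃ A : Matrix ι ι ℝ[X], G = Aᵀ * A := by
  induction N with
  | zero =>
    intro G m d hG hs hd hd0 hm hN
    have hm0 : ∀ i, m i = 0 := fun i => by simpa using (Finset.sum_eq_zero_iff.mp hN) i
    have hdeg := hG.natDegree_le hs m hm
    set L : Matrix ι ι ℝ := Matrix.of fun i j => (G i j).coeff 0 with hLdef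
    have hGL : G = L.map Polynomial.C := by
      refine Matrix.ext fun i j => ?_
      have h1 := hdeg i j
      rw [hm0, hm0] at h1
      exact Polynomial.eq_C_of_natDegree_le_zero h1
    have hL : L.PosSemidef := by
      refine Matrix.posSemidef_iff_dotProduct_mulVec.mpr ⟨?_, ?_⟩
      · ext i j
        have := congrFun (congrFun hs i) j
        simp only [Matrix.transpose_apply] at this
        simp [hLdef, this]
      · intro x
        have := hG (fun i => Polynomial.C (x i)) 0
        rw [hGL] at this
        simpa [dotProduct, Matrix.mulVec, Polynomial.eval_finsetSum] using this
    obtain ⟨B, hB⟩ := real_factor L hL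
    refine ⟨B.map Polynomial.C, ?_⟩
    rw [hGL, hB, Matrix.map_mul, Matrix.transpose_map]
  | succ N ih =>
    intro G m d hG hs hd hd0 hm hN
    have hdeg := hG.natDegree_le hs m hm
    have hdet := coeff_det G m hdeg
    rw [hd, hN, Polynomial.coeff_C_of_ne_zero (by omega)] at hdet
    obtain ⟨c, hc0, hc⟩ := Matrix.exists_mulVec_eq_zero_iff.mpr hdet.symm
    have hsupp : (Finset.univ.filter fun i => c i ≠ 0).Nonempty := by
      obtain ⟨i, hi⟩ := Function.ne_iff.mp hc0
      exact ⟨i, by simpa using hi⟩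
    obtain ⟨i, hi, hmax⟩ := Finset.exists_max_image _ m hsupp
    have hci : c i ≠ 0 := by simpa using hi
    have hmax' : ∀ j, c j ≠ 0 → m j ≤ m i := fun j hj => hmax j (by simpa using hj)
    set v : ι → ℝ[X] := fun j => Polynomial.C (c j / c i) * Polynomial.X ^ (m i - m j) with hv
    have hvi : v i = 1 := by simp [hv, hci]
    -- the norm of v
    have hterm : ∀ j k, (v j * (G j k * v k)).natDegree ≤ 2 * m i ∧
        (v j * (G j k * v k)).coeff (2 * m i) =
          c j / c i * ((G j k).coeff (m j + m k) * (c k / c i)) := by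
      intro j k
      by_cases hj : c j = 0
      · simp [hv, hj]
      by_cases hk : c k = 0
      · simp [hv, hk]
      have h1 := hmax' j hj
      have h2 := hmax' k hk
      have e : v j * (G j k * v k) = Polynomial.C (c j / c i * (c k / c i)) *
          (G j k * Polynomial.X ^ (m i - m j + (m i - m k))) := by
        simp only [hv, Polynomial.C_mul, pow_add]; ring
      have e2 : 2 * m i = m j + m k + (m i - m j + (m i - m k)) := by omega
      rw [e]
      constructor
      · refine (Polynomial.natDegree_C_mul_le _ _).trans ?_
        refine Polynomial.natDegree_mul_le.trans ?_
        rw [Polynomial.natDegree_X_pow]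
        have := hdeg j k
        omega
      · rw [Polynomial.coeff_C_mul, e2, Polynomial.coeff_mul_X_pow]
        ring
    have hq : v ⬝ᵥ G *ᵥ v = ∑ j, ∑ k, v j * (G j k * v k) := by
      simp [dotProduct, Matrix.mulVec, Finset.mul_sum]
    have hqdeg : (v ⬝ᵥ G *ᵥ v).natDegree ≤ 2 * m i := by
      rw [hq]
      exact Polynomial.natDegree_sum_le_of_forall_le _ _ fun j _ =>
        Polynomial.natDegree_sum_le_of_forall_le _ _ fun k _ => (hterm j k).1
    have hqcoeff : (v ⬝ᵥ G *ᵥ v).coeff (2 * m i) = 0 := by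
      rw [hq, Polynomial.finsetSum_coeff]
      refine Finset.sum_eq_zero fun j _ => ?_
      rw [Polynomial.finsetSum_coeff]
      simp only [(hterm j _).2]
      have := congrFun hc j
      simp only [Matrix.mulVec, dotProduct, Matrix.of_apply, Pi.zero_apply] at this
      rw [← Finset.mul_sum]
      simp only [← mul_div_assoc]
      rw [← Finset.sum_div, this]; simp
    have hq0 : v ⬝ᵥ G *ᵥ v ≠ 0 := by
      intro h0
      have h1 := hG.mulVec_eq_zero hs v h0
      have : G.det = 0 := Matrix.exists_mulVec_eq_zero_iff.mp ⟨v, by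
        intro h; rw [h] at hvi; simp at hvi, h1⟩
      rw [hd] at this
      exact hd0 (by simpa using this)
    have hlt : (v ⬝ᵥ G *ᵥ v).natDegree ≠ 2 * m i := by
      intro h
      rw [← h] at hqcoeff
      exact hq0 (Polynomial.leadingCoeff_eq_zero.mp hqcoeff)
    obtain ⟨e, he⟩ := natDegree_even _ (hG v)
    obtain ⟨T, G', hGT, hTd, hG', hs', hii, hkk⟩ := descent hG hs 1 one_ne_zero v i hvi
      (fun k => one_dvd _) (by simp)
    have hmi : 1 ≤ m i := by omega
    obtain ⟨A, hA⟩ := ih G' (Function.update m i (m i - 1)) d hG' hs' (by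
      rw [← hd, hGT]; simp [Matrix.det_mul, hTd]) hd0 (by
      intro k
      by_cases hk : k = i
      · subst hk
        rw [one_pow, one_mul] at hii
        rw [hii, Function.update_self]; omega
      · rw [hkk k hk, Function.update_of_ne hk]; exact hm k) (by
      have h1 := Finset.sum_update_of_mem (Finset.mem_univ i) m (m i - 1)
      have h2 := Finset.add_sum_erase Finset.univ m (Finset.mem_univ i)
      rw [Finset.sdiff_singleton_eq_erase] at h1
      omega)
    exact ⟨A * T, by rw [hGT, hA, Matrix.transpose_mul]; simp only [Matrix.mul_assoc]⟩

/-- A vector which can be divided by `p`. -/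
def Good (G : Matrix ι ι ℝ[X]) (p : ℝ[X]) (v : ι → ℝ[X]) : Prop :=
  (∀ k, p ∣ (G *ᵥ v) k) ∧ p ^ 2 ∣ v ⬝ᵥ G *ᵥ v

lemma normalise {G : Matrix ι ι ℝ[X]} (hs : Gᵀ = G) (p : ℝ[X]) (v : ι → ℝ[X]) (i : ι) (a : ℝ[X])
    (ha : p ∣ a * v i - 1) (hv : Good G p v) : ∃ v', v' i = 1 ∧ Good G p v' := by
  obtain ⟨k, hk⟩ := ha
  refine ⟨a • v - (p * k) • Pi.single i 1, ?_, ?_, ?_⟩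
  · simp only [Pi.sub_apply, Pi.smul_apply, smul_eq_mul, Pi.single_eq_same, mul_one]
    rw [← hk]; ring
  · intro l
    rw [Matrix.mulVec_sub, Matrix.mulVec_smul, Matrix.mulVec_smul]
    simp only [Pi.sub_apply, Pi.smul_apply, smul_eq_mul]
    exact dvd_sub (Dvd.dvd.mul_left (hv.1 l) _) (by rw [mul_assoc]; exact dvd_mul_right _ _)
  · rw [Matrix.mulVec_sub, Matrix.mulVec_smul, Matrix.mulVec_smul]
    simp only [dotProduct_sub, sub_dotProduct, smul_dotProduct, dotProduct_smul, smul_eq_mul]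
    rw [symm_dot hs v (Pi.single i 1)]
    obtain ⟨x, hx⟩ := hv.1 i
    obtain ⟨y, hy⟩ := hv.2
    have : Pi.single i 1 ⬝ᵥ G *ᵥ v = p * x := by simpa using hx
    rw [this, hy]
    exact ⟨a * (a * y) - 2 * (a * k * x) + k * k * (Pi.single i 1 ⬝ᵥ G *ᵥ Pi.single i 1), by ring⟩

lemma find_real {G : Matrix ι ι ℝ[X]} (hG : PSD G) (x : ℝ)
    (hx : G.det.eval x = 0) : ∃ v i, v i = 1 ∧ Good G (Polynomial.X - Polynomial.C x) v := by
  have h0 : ((Polynomial.evalRingHom x).mapMatrix G).det = 0 := by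
    rw [← RingHom.map_det]; exact hx
  obtain ⟨c, hc0, hc⟩ := Matrix.exists_mulVec_eq_zero_iff.mpr h0
  obtain ⟨i, hi⟩ := Function.ne_iff.mp hc0
  simp only [Pi.zero_apply] at hi
  set v : ι → ℝ[X] := fun j => Polynomial.C (c j / c i) with hv
  have h1 : ∀ k, ((G *ᵥ v) k).eval x = 0 := by
    intro k
    have := congrFun hc k
    simp only [Matrix.mulVec, dotProduct, RingHom.mapMatrix_apply, Matrix.map_apply,
      Polynomial.coe_evalRingHom, Pi.zero_apply] at this
    simp only [hv, Matrix.mulVec, dotProduct, Polynomial.eval_finsetSum, Polynomial.eval_mul,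
      Polynomial.eval_C, ← mul_div_assoc]
    rw [← Finset.sum_div, this, zero_div]
  have h1' : ∀ k, (Polynomial.X - Polynomial.C x) ∣ (G *ᵥ v) k := fun k =>
    Polynomial.dvd_iff_isRoot.mpr (h1 k)
  refine ⟨v, i, by simp [hv, hi], h1', ?_⟩
  have h2 : (Polynomial.X - Polynomial.C x) ∣ v ⬝ᵥ G *ᵥ v :=
    Finset.dvd_sum fun k _ => Dvd.dvd.mul_left (h1' k) _
  obtain ⟨f, hf⟩ := h2
  have hpos := hG v
  rw [hf] at hpos
  have hfx : f.eval x = 0 := by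
    by_contra hne
    -- sign change at x
    have hcont : ContinuousAt (fun t => f.eval t) x := f.continuous.continuousAt
    have hmul : ∀ t, 0 ≤ (t - x) * f.eval t := fun t => by simpa using hpos t
    rcases lt_or_gt_of_ne hne with hlt | hgt
    · have h3 := hcont.eventually (gt_mem_nhds hlt)
      obtain ⟨t, ht, htx⟩ := ((h3.filter_mono nhdsWithin_le_nhds).and
        (self_mem_nhdsWithin (s := Set.Ioi x) (a := x))).exists
      have := hmul t
      have : 0 < t - x := sub_pos.mpr htx
      nlinarith
    · have h3 := hcont.eventually (lt_mem_nhds hgt)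
      obtain ⟨t, ht, htx⟩ := ((h3.filter_mono nhdsWithin_le_nhds).and
        (self_mem_nhdsWithin (s := Set.Iio x) (a := x))).exists
      have := hmul t
      have : t - x < 0 := sub_neg.mpr htx
      nlinarith
  rw [hf, pow_two]
  exact mul_dvd_mul_left _ (Polynomial.dvd_iff_isRoot.mpr hfx)

lemma lift_complex (z : ℂ) (hz : z.im ≠ 0) (w : ℂ) : ∃ f : ℝ[X], aeval z f = w := by
  refine ⟨Polynomial.C (w.re - w.im / z.im * z.re) + Polynomial.C (w.im / z.im) * Polynomial.X, ?_⟩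
  simp only [map_add, map_mul, Polynomial.aeval_C, Polynomial.aeval_X]
  apply Complex.ext
  · simp
  · simp [hz]

lemma find_complex {G : Matrix ι ι ℝ[X]} (hs : Gᵀ = G) (z : ℂ) (hz : z.im ≠ 0)
    (p : ℝ[X]) (hp : ∀ f : ℝ[X], p ∣ f ↔ aeval z f = 0) (hpn : p ≠ 0) (hdet : p ^ 2 ∣ G.det) :
    ∃ v i, v i = 1 ∧ Good G p v := by
  suffices h : ∃ v : ι → ℝ[X], Good G p v ∧ ∃ i, aeval z (v i) ≠ 0 by
    obtain ⟨v, hv, i, hi⟩ := h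
    obtain ⟨a, ha⟩ := lift_complex z hz (aeval z (v i))⁻¹
    obtain ⟨v', h1, h2⟩ := normalise hs p v i a ((hp _).mpr (by simp [ha, hi])) hv
    exact ⟨v', i, h1, h2⟩
  set φ : ℝ[X] →+* ℂ := (aeval z : ℝ[X] →ₐ[ℝ] ℂ).toRingHom with hφ
  have hφa : ∀ f, φ f = aeval z f := fun f => rfl
  simp only [← hφa] at hp ⊢
  have hp2 : p ∣ G.det := (dvd_pow_self p two_ne_zero).trans hdet
  have hGz : (φ.mapMatrix G).det = 0 := by
    rw [← RingHom.map_det]; exact (hp _).mp hp2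
  obtain ⟨c, hc0, hc⟩ := Matrix.exists_mulVec_eq_zero_iff.mpr hGz
  obtain ⟨i, hi⟩ := Function.ne_iff.mp hc0
  simp only [Pi.zero_apply] at hi
  by_cases hadj : φ (G.adjugate i i) = 0
  · -- second kernel vector
    have h0 : ((φ.mapMatrix G).updateRow i (Pi.single i 1)).det = 0 := by
      rw [← Matrix.adjugate_apply, ← RingHom.map_adjugate]; exact hadj
    obtain ⟨u, hu0, hu⟩ := Matrix.exists_mulVec_eq_zero_iff.mpr h0
    have hui : u i = 0 := by
      have := congrFun hu i
      simpa [Matrix.mulVec, Matrix.updateRow_self] using this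
    have huk : ∀ k, k ≠ i → (φ.mapMatrix G *ᵥ u) k = 0 := by
      intro k hk
      have := congrFun hu k
      simpa [Matrix.mulVec, Matrix.updateRow_ne hk] using this
    have hsz : (φ.mapMatrix G)ᵀ = φ.mapMatrix G := by
      rw [RingHom.mapMatrix_apply, ← Matrix.transpose_map, hs]
    have hGu : φ.mapMatrix G *ᵥ u = 0 := by
      have h1 : c ⬝ᵥ φ.mapMatrix G *ᵥ u = 0 := by
        rw [Matrix.dotProduct_mulVec, ← Matrix.mulVec_transpose, hsz, hc, zero_dotProduct]
      rw [dotProduct, Finset.sum_eq_single i (fun k _ hk => by rw [huk k hk, mul_zero])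
        (fun h => absurd (Finset.mem_univ i) h)] at h1
      funext k
      by_cases hk : k = i
      · subst hk
        simpa [hi] using h1
      · exact huk k hk
    -- lifts
    choose V1 hV1 using fun k => lift_complex z hz (c k)
    choose V2 hV2 using fun k => lift_complex z hz (u k)
    have hlift : ∀ (V : ι → ℝ[X]) (y : ι → ℂ), (∀ k, aeval z (V k) = y k) →
        φ.mapMatrix G *ᵥ y = 0 → ∀ k, p ∣ (G *ᵥ V) k := by
      intro V y hV hy k
      rw [hp, RingHom.map_mulVec]
      have : φ ∘ V = y := funext hV
      rw [this]
      exact congrFun hy k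
    choose W1 hW1 using hlift V1 c hV1 hc
    choose W2 hW2 using hlift V2 u hV2 hGu
    have hW1' : G *ᵥ V1 = p • W1 := funext hW1
    have hW2' : G *ᵥ V2 = p • W2 := funext hW2
    have hsym : V2 ⬝ᵥ W1 = V1 ⬝ᵥ W2 := by
      have := symm_dot hs V2 V1
      rw [hW1', hW2', dotProduct_smul, dotProduct_smul] at this
      exact mul_left_cancel₀ hpn this
    by_cases hcc : φ (V2 ⬝ᵥ W2) = 0
    · refine ⟨V2, ⟨fun k => ⟨_, hW2 k⟩, ?_⟩, ?_⟩
      · rw [hW2', dotProduct_smul, smul_eq_mul, pow_two]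
        exact mul_dvd_mul_left _ ((hp _).mpr hcc)
      · obtain ⟨k, hk⟩ := Function.ne_iff.mp hu0
        exact ⟨k, by rw [hφa, hV2]; exact hk⟩
    · obtain ⟨lam, hlam⟩ := exists_quadratic_eq_zero (a := φ (V2 ⬝ᵥ W2))
        (b := 2 * φ (V1 ⬝ᵥ W2)) (c := φ (V1 ⬝ᵥ W1)) hcc (IsAlgClosed.exists_eq_mul_self _)
      obtain ⟨ℓ, hℓ⟩ := lift_complex z hz lam
      have hGv : G *ᵥ (V1 + ℓ • V2) = p • (W1 + ℓ • W2) := by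
        rw [Matrix.mulVec_add, Matrix.mulVec_smul, hW1', hW2', smul_add, smul_comm]
      refine ⟨V1 + ℓ • V2, ⟨fun k => ⟨_, congrFun hGv k⟩, ?_⟩, i, ?_⟩
      · rw [hGv, dotProduct_smul, smul_eq_mul, pow_two]
        refine mul_dvd_mul_left _ ((hp _).mpr ?_)
        simp only [dotProduct_add, add_dotProduct, smul_dotProduct, dotProduct_smul, smul_eq_mul,
          hsym, map_add, map_mul]
        rw [show φ ℓ = lam from hℓ]
        linear_combination hlam
      · simp only [Pi.add_apply, Pi.smul_apply, smul_eq_mul, map_add, map_mul]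
        rw [show φ (V1 i) = c i from hV1 i, show φ (V2 i) = u i from hV2 i, hui]
        simpa using hi
  · have hGv : G *ᵥ (G.adjugate *ᵥ Pi.single i 1) = G.det • Pi.single i 1 := by
      rw [Matrix.mulVec_mulVec, Matrix.mul_adjugate, Matrix.smul_mulVec, Matrix.one_mulVec]
    refine ⟨G.adjugate *ᵥ Pi.single i 1, ⟨fun k => ?_, ?_⟩, i, ?_⟩
    · rw [hGv]; exact Dvd.dvd.mul_right hp2 _
    · rw [hGv, dotProduct_smul]; exact Dvd.dvd.mul_right hdet _
    · simpa using hadj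

lemma stepA (N : ℕ) : ∀ (G : Matrix ι ι ℝ[X]) (s : ℝ[X]), PSD G → Gᵀ = G →
    G.det = s ^ 2 → s ≠ 0 → s.natDegree ≤ N → ∃ A : Matrix ι ι ℝ[X], G = Aᵀ * A := by
  induction N with
  | zero =>
    intro G s hG hs hd hs0 hN
    rw [Polynomial.eq_C_of_natDegree_le_zero hN] at hd hs0
    refine stepB _ G (fun i => (G i i).natDegree) ((s.coeff 0) ^ 2) hG hs (by simpa using hd) ?_
      (fun i => by omega) rfl
    intro h
    apply hs0
    simpa using h
  | succ N ih =>
    intro G s hG hs hd hs0 hN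
    by_cases hN' : s.natDegree ≤ N
    · exact ih G s hG hs hd hs0 hN'
    obtain ⟨z, hz⟩ := IsAlgClosed.exists_aeval_eq_zero ℂ s (by
      intro h
      have := Polynomial.natDegree_eq_zero_iff_degree_le_zero.mpr h.le
      omega)
    have key : ∃ (p : ℝ[X]) (v : ι → ℝ[X]) (i : ι), p ∣ s ∧ 0 < p.natDegree ∧ v i = 1 ∧
        Good G p v := by
      by_cases him : z.im = 0
      · have hzr : z = algebraMap ℝ ℂ z.re := by
          apply Complex.ext <;> simp [him]
        rw [hzr, Polynomial.aeval_algebraMap_apply] at hz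
        have hsx : s.eval z.re = 0 := by simpa using hz
        obtain ⟨v, i, h1, h2⟩ := find_real hG z.re (by rw [hd]; simp [hsx])
        exact ⟨_, v, i, Polynomial.dvd_iff_isRoot.mpr hsx, by simp, h1, h2⟩
      · set p : ℝ[X] := Polynomial.X ^ 2 - Polynomial.C (2 * z.re) * Polynomial.X +
          Polynomial.C (‖z‖ ^ 2) with hpdef
        have hpz : aeval z p = 0 := by
          have hn : ‖z‖ ^ 2 = z.re * z.re + z.im * z.im := by
            rw [← Complex.normSq_eq_norm_sq, Complex.normSq_apply]
          simp only [hpdef, hn, map_add, map_sub, map_mul, map_pow, Polynomial.aeval_X,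
            Polynomial.aeval_C]
          apply Complex.ext
          · simp [pow_two]; ring
          · simp [pow_two]; ring
        have hp : ∀ f : ℝ[X], p ∣ f ↔ aeval z f = 0 := by
          intro f
          constructor
          · rintro ⟨g, rfl⟩; rw [map_mul, hpz, zero_mul]
          · intro h; exact f.quadratic_dvd_of_aeval_eq_zero_im_ne_zero h him
        have hps : p ∣ s := (hp s).mpr hz
        obtain ⟨v, i, h1, h2⟩ := find_complex hs z him p hp
          (fun h => hs0 (by rw [h] at hps; exact zero_dvd_iff.mp hps)) (by rw [hd]; exact pow_dvd_pow_of_dvd hps 2)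
        refine ⟨p, v, i, hps, ?_, h1, h2⟩
        have : p.natDegree = 2 := by rw [hpdef]; compute_degree!
        omega
    obtain ⟨p, v, i, ⟨q, rfl⟩, hp, hvi, hv1, hv2⟩ := key
    have hp0 : p ≠ 0 := left_ne_zero_of_mul hs0
    have hq0 : q ≠ 0 := right_ne_zero_of_mul hs0
    obtain ⟨T, G', hGT, hTd, hG', hs', -, -⟩ := descent hG hs p hp0 v i hvi hv1 hv2
    obtain ⟨A, hA⟩ := ih G' q hG' hs' (by
      rw [hGT, Matrix.det_mul, Matrix.det_mul, Matrix.det_transpose, hTd] at hd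
      apply mul_left_cancel₀ (pow_ne_zero 2 hp0)
      linear_combination hd) hq0 (by
      rw [Polynomial.natDegree_mul hp0 hq0] at hN; omega)
    exact ⟨A * T, by rw [hGT, hA, Matrix.transpose_mul]; simp only [Matrix.mul_assoc]⟩

lemma gram_self {κ : Type} [Fintype κ] (B : Matrix κ ι ℝ[X]) (v : ι → ℝ[X]) :
    v ⬝ᵥ (Bᵀ * B) *ᵥ v = ∑ k, ((B *ᵥ v) k) ^ 2 := by
  rw [← Matrix.mulVec_mulVec, Matrix.dotProduct_mulVec, Matrix.vecMul_transpose, dotProduct]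
  simp [pow_two]

lemma gram_psd {κ : Type} [Fintype κ] (B : Matrix κ ι ℝ[X]) : PSD (Bᵀ * B) := by
  intro v t
  rw [gram_self, Polynomial.eval_finsetSum]
  exact Finset.sum_nonneg fun k _ => by rw [Polynomial.eval_pow]; positivity

lemma gram_det_ne {κ : Type} [Fintype κ] (B : Matrix κ ι ℝ[X])
    (hB : ∀ v, B *ᵥ v = 0 → v = 0) : (Bᵀ * B).det ≠ 0 := by
  intro h
  obtain ⟨v, hv0, hv⟩ := Matrix.exists_mulVec_eq_zero_iff.mpr h
  apply hv0
  apply hB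
  have h1 := gram_self B v
  rw [hv, dotProduct_zero] at h1
  funext k
  apply Polynomial.funext
  intro t
  have h2 := congrArg (Polynomial.eval t) h1
  rw [Polynomial.eval_finsetSum, Polynomial.eval_zero] at h2
  have h3 := (Finset.sum_eq_zero_iff_of_nonneg
    (fun k _ => by rw [Polynomial.eval_pow]; positivity)).mp h2.symm k (Finset.mem_univ k)
  simpa using h3

lemma gram_det_nonneg {κ : Type} [Fintype κ] (B : Matrix κ ι ℝ[X]) (t : ℝ) :
    0 ≤ (Bᵀ * B).det.eval t := by
  rw [← Polynomial.coe_evalRingHom, RingHom.map_det, RingHom.mapMatrix_apply, Matrix.map_mul,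
    Matrix.transpose_map]
  exact (Matrix.posSemidef_conjTranspose_mul_self (B.map (Polynomial.evalRingHom t))).det_nonneg

lemma gram_inj {κ : Type} [Fintype κ] (B : Matrix κ ι ℝ[X])
    (hB : ∀ v, B *ᵥ v = 0 → v = 0) :
    ∃ A : Matrix (ι ⊕ Unit) ι ℝ[X], Bᵀ * B = Aᵀ * A := by
  set M := Bᵀ * B with hM
  have hd0 : M.det ≠ 0 := gram_det_ne B hB
  have hMs : Mᵀ = M := by rw [hM, Matrix.transpose_mul, Matrix.transpose_transpose]
  set D : Matrix Unit Unit ℝ[X] := Matrix.of fun _ _ => M.det with hD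
  set G : Matrix (ι ⊕ Unit) (ι ⊕ Unit) ℝ[X] := Matrix.fromBlocks M 0 0 D with hG
  have hdet : G.det = M.det ^ 2 := by
    rw [hG, Matrix.det_fromBlocks_zero₂₁, pow_two]
    simp [hD]
  have hGs : Gᵀ = G := by
    rw [hG, Matrix.fromBlocks_transpose, hMs]
    simp
    rfl
  have hpsd : PSD G := by
    intro v t
    have h1 := gram_psd B (v ∘ Sum.inl) t
    have h2 : v ⬝ᵥ G *ᵥ v = (v ∘ Sum.inl) ⬝ᵥ M *ᵥ (v ∘ Sum.inl)
        + (v (Sum.inr ())) ^ 2 * M.det := by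
      rw [hG, Matrix.fromBlocks_mulVec]
      simp [dotProduct, Matrix.mulVec, hD, Fintype.sum_sum_type]
      ring
    rw [h2, Polynomial.eval_add, Polynomial.eval_mul, Polynomial.eval_pow]
    exact add_nonneg h1 (mul_nonneg (sq_nonneg _) (gram_det_nonneg B t))
  obtain ⟨A, hA⟩ := stepA _ G M.det hpsd hGs hdet hd0 le_rfl
  refine ⟨A.submatrix id Sum.inl, ?_⟩
  refine Matrix.ext fun i j => ?_
  have := congrFun (congrFun hA (Sum.inl i)) (Sum.inl j)
  simpa [hG, Matrix.mul_apply] using this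

lemma gram_main {κ : Type} [Fintype κ] (B : Matrix κ ι ℝ[X]) :
    ∃ (s : ℕ) (_ : s ≤ Fintype.card ι) (A : Matrix (Fin s ⊕ Unit) ι ℝ[X]), Bᵀ * B = Aᵀ * A := by
  set W := LinearMap.range B.mulVecLin with hW
  have hle : Module.finrank ℝ[X] W ≤ Fintype.card ι := by
    have := LinearMap.finrank_range_le B.mulVecLin
    simpa using this
  let b := Module.finBasis ℝ[X] W
  set B' : Matrix κ (Fin (Module.finrank ℝ[X] W)) ℝ[X] :=
    Matrix.of fun k l => (b l : κ → ℝ[X]) k with hB'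
  have hB'v : ∀ v, B' *ᵥ v = ((∑ l, v l • b l : W) : κ → ℝ[X]) := by
    intro v
    funext k
    simp [hB', Matrix.mulVec, dotProduct, mul_comm]
  have hinj : ∀ v, B' *ᵥ v = 0 → v = 0 := by
    intro v hv
    rw [hB'v] at hv
    have h1 : (∑ l, v l • b l : W) = 0 := Subtype.ext hv
    funext l
    exact Fintype.linearIndependent_iff.mp b.linearIndependent v h1 l
  obtain ⟨A, hA⟩ := gram_inj B' hinj
  have hmem : ∀ j, B *ᵥ Pi.single j 1 ∈ W := fun j => ⟨Pi.single j 1, rfl⟩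
  set R : Matrix (Fin (Module.finrank ℝ[X] W)) ι ℝ[X] :=
    Matrix.of fun l j => b.repr ⟨B *ᵥ Pi.single j 1, hmem j⟩ l with hR
  have hBR : B = B' * R := by
    refine Matrix.ext fun k j => ?_
    have h1 := hB'v (fun l => R l j)
    have h2 : (∑ l, R l j • b l : W) = ⟨B *ᵥ Pi.single j 1, hmem j⟩ :=
      b.sum_repr ⟨B *ᵥ Pi.single j 1, hmem j⟩
    rw [h2] at h1
    have h3 := congrFun h1 k
    simp only [Matrix.mulVec_single_one] at h3
    exact h3.symm
  refine ⟨_, hle, A * R, ?_⟩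
  calc Bᵀ * B = Rᵀ * (B'ᵀ * B') * R := by
        rw [hBR, Matrix.transpose_mul]; simp only [Matrix.mul_assoc]
    _ = (A * R)ᵀ * (A * R) := by
        rw [hA, Matrix.transpose_mul]; simp only [Matrix.mul_assoc]

/-- The linear form with coefficient vector `a`. -/
noncomputable def lin (a : ι → ℝ[X]) : MvPolynomial ι ℝ[X] :=
  ∑ j, MvPolynomial.C (a j) * MvPolynomial.X j

lemma lin_hom (a : ι → ℝ[X]) : (lin a).IsHomogeneous 1 := by
  refine MvPolynomial.IsHomogeneous.sum _ _ _ fun j _ => ?_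
  simpa using (MvPolynomial.isHomogeneous_C ι (a j)).mul (MvPolynomial.isHomogeneous_X ℝ[X] j)

lemma hom_lin (l : MvPolynomial ι ℝ[X]) (hl : l.IsHomogeneous 1) :
    l = lin fun j => l.coeff (Finsupp.single j 1) := by
  ext1 d
  by_cases hd : d.degree = 1
  · obtain ⟨i, rfl⟩ : ∃ i, d = Finsupp.single i 1 := by
      exact (Finsupp.sum_eq_one_iff d).mp hd
    simp [lin, MvPolynomial.coeff_sum, MvPolynomial.coeff_C_mul, MvPolynomial.coeff_X,
      Finsupp.single_left_inj]
  · rw [hl.coeff_eq_zero hd, (lin_hom _).coeff_eq_zero hd]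

lemma sum_sq_lin {κ : Type} [Fintype κ] (B : Matrix κ ι ℝ[X]) :
    ∑ k, lin (B k) ^ 2 = ∑ i, ∑ j, MvPolynomial.C ((Bᵀ * B) i j) *
      (MvPolynomial.X i * MvPolynomial.X j) := by
  have h1 : ∀ k, lin (B k) ^ 2 = ∑ i, ∑ j, MvPolynomial.C (B k i * B k j) *
      (MvPolynomial.X i * MvPolynomial.X j) := by
    intro k
    rw [lin, pow_two, Finset.sum_mul_sum]
    refine Finset.sum_congr rfl fun i _ => Finset.sum_congr rfl fun j _ => ?_
    rw [map_mul]; ring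
  simp only [h1]
  rw [Finset.sum_comm]
  refine Finset.sum_congr rfl fun i _ => ?_
  rw [Finset.sum_comm]
  refine Finset.sum_congr rfl fun j _ => ?_
  rw [Matrix.mul_apply, map_sum, Finset.sum_mul]
  rfl

lemma eval_sum_sq_lin {κ : Type} [Fintype κ] (B : Matrix κ ι ℝ[X]) (u : ι → ℝ[X]) :
    MvPolynomial.eval u (∑ k, lin (B k) ^ 2) = u ⬝ᵥ (Bᵀ * B) *ᵥ u := by
  rw [gram_self]
  simp [lin, Matrix.mulVec, dotProduct]

lemma gram_ext {G H : Matrix ι ι ℝ[X]} (hG : Gᵀ = G) (hH : Hᵀ = H)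
    (h : ∀ u, u ⬝ᵥ G *ᵥ u = u ⬝ᵥ H *ᵥ u) : G = H := by
  refine Matrix.ext fun i j => ?_
  have h1 := h (Pi.single i 1 + Pi.single j 1)
  have h2 := h (Pi.single i 1)
  have h3 := h (Pi.single j 1)
  simp only [Matrix.mulVec_add, dotProduct_add, add_dotProduct] at h1
  rw [symm_dot hG (Pi.single j 1) (Pi.single i 1), symm_dot hH (Pi.single j 1) (Pi.single i 1),
    h2, h3] at h1
  have h4 : (2 : ℝ[X]) * (Pi.single i 1 ⬝ᵥ G *ᵥ Pi.single j 1)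
      = 2 * (Pi.single i 1 ⬝ᵥ H *ᵥ Pi.single j 1) := by linear_combination h1
  simpa using mul_left_cancel₀ two_ne_zero h4

lemma not_square (q : ℝ[X]) : (1 + Polynomial.X ^ 2 : ℝ[X]) ≠ q ^ 2 := by
  intro h
  have hq : q.natDegree ≤ 1 := by
    have h1 := congrArg Polynomial.natDegree h
    rw [Polynomial.natDegree_pow, show (1 + Polynomial.X ^ 2 : ℝ[X]).natDegree = 2 by
      compute_degree!] at h1
    omega
  obtain ⟨a, b, rfl⟩ := Polynomial.exists_eq_X_add_C_of_natDegree_le_one hq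
  have e0 := congrArg (Polynomial.eval 0) h
  have e1 := congrArg (Polynomial.eval 1) h
  have e2 := congrArg (Polynomial.eval (-1)) h
  simp at e0 e1 e2
  have hab : a * b = 0 := by nlinarith
  rcases mul_eq_zero.mp hab with rfl | rfl
  · nlinarith
  · norm_num at e0

end LeepProof

open MvPolynomial

/-- Leep's theorem for `R = ℝ`: `g_r(ℝ[t]) = r + 1`. Every finite sum of squares
of linear forms in `ℝ[t][x_1,…,x_r]` is a sum of `r+1` squares of linear forms,
and `r+1` is optimal. -/
theorem g_r_of_polynomial_ring (r : ℕ) (hr : 1 ≤ r) :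
    (∀ (N : ℕ) (l : Fin N → MvPolynomial (Fin r) (Polynomial ℝ)),
      (∀ i, (l i).IsHomogeneous 1) →
      ∃ l' : Fin (r + 1) → MvPolynomial (Fin r) (Polynomial ℝ),
        (∀ j, (l' j).IsHomogeneous 1) ∧ ∑ i, l i ^ 2 = ∑ j, l' j ^ 2) ∧
    (∃ (N : ℕ) (l : Fin N → MvPolynomial (Fin r) (Polynomial ℝ)),
      (∀ i, (l i).IsHomogeneous 1) ∧
      ¬ ∃ l' : Fin r → MvPolynomial (Fin r) (Polynomial ℝ),
        (∀ j, (l' j).IsHomogeneous 1) ∧ ∑ i, l i ^ 2 = ∑ j, l' j ^ 2) := by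
  constructor
  · intro N l hl
    let B : Matrix (Fin N) (Fin r) (Polynomial ℝ) := fun i j => (l i).coeff (Finsupp.single j 1)
    have hB : ∀ i, l i = LeepProof.lin (B i) := fun i => LeepProof.hom_lin (l i) (hl i)
    obtain ⟨s, hs, A, hA⟩ := LeepProof.gram_main B
    rw [Fintype.card_fin] at hs
    obtain ⟨e⟩ : Nonempty (Fin s ⊕ Unit ↪ Fin (r + 1)) := by
      rw [Function.Embedding.nonempty_iff_card_le]
      simpa using hs
    refine ⟨Function.extend e (fun k => LeepProof.lin (A k)) 0, ?_, ?_⟩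
    · intro j
      by_cases hj : ∃ k, e k = j
      · obtain ⟨k, rfl⟩ := hj
        rw [e.injective.extend_apply]
        exact LeepProof.lin_hom _
      · rw [Function.extend_apply' _ _ _ hj]
        exact MvPolynomial.isHomogeneous_zero _ _ _
    · have h1 : ∑ i, l i ^ 2 = ∑ k, LeepProof.lin (A k) ^ 2 := by
        simp only [hB]
        rw [LeepProof.sum_sq_lin, LeepProof.sum_sq_lin, hA]
      rw [h1]
      refine Fintype.sum_of_injective e e.injective _ _ ?_ ?_
      · intro j hj
        rw [Function.extend_apply' _ _ _ (by simpa using hj)]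
        simp
      · intro k
        rw [e.injective.extend_apply]
  · let z : Fin r := ⟨0, hr⟩
    let B : Matrix (Fin (r + 1)) (Fin r) (Polynomial ℝ) :=
      Fin.snoc (α := fun _ => Fin r → Polynomial ℝ) (fun i => Pi.single i 1)
        (Pi.single z Polynomial.X)
    refine ⟨r + 1, fun i => LeepProof.lin (B i), fun i => LeepProof.lin_hom _, ?_⟩
    rintro ⟨l', hl', heq⟩
    let A : Matrix (Fin r) (Fin r) (Polynomial ℝ) := fun i j => (l' i).coeff (Finsupp.single j 1)
    have hA : ∀ i, l' i = LeepProof.lin (A i) := fun i => LeepProof.hom_lin (l' i) (hl' i)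
    simp only [hA] at heq
    have hBA : B.transpose * B = A.transpose * A := by
      refine LeepProof.gram_ext (by simp [Matrix.transpose_mul]) (by simp [Matrix.transpose_mul]) ?_
      intro u
      rw [← LeepProof.eval_sum_sq_lin, ← LeepProof.eval_sum_sq_lin, heq]
    have hBc : ∀ i : Fin r, B i.castSucc = Pi.single i 1 := fun i => by simp [B]
    have hBl : B (Fin.last r) = Pi.single z Polynomial.X := by simp [B]
    have hdiag : B.transpose * B =
        Matrix.diagonal (Function.update 1 z (1 + Polynomial.X ^ 2)) := by
      refine Matrix.ext fun i j => ?_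
      rw [Matrix.mul_apply, Fin.sum_univ_castSucc]
      simp only [Matrix.transpose_apply, hBc, hBl]
      by_cases hij : i = j
      · subst hij
        by_cases hi : i = z
        · simp [hi, Pi.single_apply, pow_two]
        · simp [hi, Pi.single_apply]
      · by_cases hi : i = z
        · have : j ≠ z := fun h => hij (hi.trans h.symm)
          simp [hij, Pi.single_apply, this, Matrix.diagonal_apply_ne _ hij, Ne.symm hij]
        · simp [hij, Pi.single_apply, hi, Matrix.diagonal_apply_ne _ hij, Ne.symm hij]
    have hdet : (1 + Polynomial.X ^ 2 : Polynomial ℝ) = A.det ^ 2 := by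
      have h1 := congrArg Matrix.det (hdiag.symm.trans hBA)
      rw [Matrix.det_diagonal, Matrix.det_mul, Matrix.det_transpose, ← pow_two,
        Finset.prod_update_of_mem (Finset.mem_univ z)] at h1
      simpa using h1
    exact LeepProof.not_square _ hdet
end

section
/- Let d ≥ 1 and m ≥ 0. If f is a form of degree 2d in ℝ[x_1,x_2,x_3] which is a sum of squares of forms of degree d, and f has a real zero of multiplicity at least 2m (i.e. there is 0 ≠ ξ ∈ ℝ³ at which all partial derivatives of f of order < 2m vanish), then ℓ(f) ≤ d + 2 − m. In particular, p(3,2d) ≤ d + 2 for all d ≥ 1. -/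
section
open MvPolynomial

noncomputable section

/-- Iterated partial derivative of `f` along a list of coordinate directions;
a partial derivative `∂^a f` of order `k` corresponds to a list of length `k`. -/
def iteratedPDeriv {n : ℕ} (l : List (Fin n)) (f : MvPolynomial (Fin n) ℝ) :
    MvPolynomial (Fin n) ℝ :=
  l.foldl (fun g i => MvPolynomial.pderiv i g) f

end
end

section
set_option linter.unusedSectionVars false
open Polynomial Matrix

def PolyNonneg (g : ℝ[X]) : Prop := ∀ t : ℝ, 0 ≤ g.eval t

lemma PolyNonneg.of_sq_mul {c g : ℝ[X]} (hc : c ≠ 0) (h : PolyNonneg (c ^ 2 * g)) :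
    PolyNonneg g := by
  intro t
  by_contra! hlt
  have hopen : IsOpen {s : ℝ | g.eval s < 0} :=
    isOpen_lt g.continuous continuous_const
  have hinf : {s : ℝ | g.eval s < 0}.Infinite :=
    infinite_of_mem_nhds t (hopen.mem_nhds hlt)
  apply hinf
  apply (Polynomial.finite_setOfPred_isRoot hc).subset
  intro s hs
  by_contra hr
  have h1 := h s
  simp only [eval_mul, eval_pow] at h1
  have h2 : 0 < (c.eval s) ^ 2 := by
    have : c.eval s ≠ 0 := hr
    positivity
  have hs' : g.eval s < 0 := hs
  nlinarith

lemma PolyNonneg.sq_dvd {g : ℝ[X]} (h : PolyNonneg g) {a : ℝ} (ha : g.eval a = 0) :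
    (X - C a) ^ 2 ∣ g := by
  by_cases hg : g = 0
  · simp [hg]
  obtain ⟨q, hq⟩ := (dvd_iff_isRoot (p := g) (a := a)).2 ha
  have hd : (derivative g).eval a = 0 := by
    have hmin : IsLocalMin (fun x => g.eval x) a := by
      apply Filter.Eventually.of_forall
      intro x
      simpa [ha] using h x
    have := hmin.deriv_eq_zero
    simpa using this
  have : q.eval a = 0 := by
    rw [hq] at hd
    simpa using hd
  obtain ⟨q', hq'⟩ := (dvd_iff_isRoot (p := q) (a := a)).2 this
  exact ⟨q', by rw [hq, hq']; ring⟩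

lemma PolyNonneg.leadingCoeff {g : ℝ[X]} (h : PolyNonneg g) : 0 ≤ g.leadingCoeff := by
  by_contra! hlt
  by_cases hd : 0 < g.degree
  · have := g.tendsto_atBot_of_leadingCoeff_nonpos hd hlt.le
    obtain ⟨x, hx⟩ := (this.eventually (Filter.eventually_lt_atBot 0)).exists
    exact absurd (h x) (not_le.2 hx)
  · have := eq_C_of_degree_le_zero (not_lt.1 hd)
    have h0 := h 0
    rw [this] at hlt h0
    simp at hlt h0
    linarith

lemma PolyNonneg.even {g : ℝ[X]} (h : PolyNonneg g) : Even g.natDegree := by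
  by_cases hg : g = 0
  · simp [hg]
  have h1 : PolyNonneg (g.comp (-X)) := by
    intro t
    simpa using h (-t)
  have h2 := h1.leadingCoeff
  rw [leadingCoeff_comp (by simp)] at h2
  by_contra ho
  rw [Nat.not_even_iff_odd] at ho
  simp [ho.neg_one_pow] at h2
  have h3 := h.leadingCoeff
  have : g.leadingCoeff = 0 := le_antisymm h2 h3
  exact hg (leadingCoeff_eq_zero.1 this)

lemma PolyNonneg.degree_le {f g : ℝ[X]} (h : PolyNonneg (g - f ^ 2)) :
    2 * f.natDegree ≤ g.natDegree := by
  by_contra! hlt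
  have h1 : (f ^ 2).natDegree = 2 * f.natDegree := by simp
  have hf : f ≠ 0 := by rintro rfl; simp at hlt
  have h2 := h.leadingCoeff
  have hdeg : g.degree < (f ^ 2).degree := by
    apply degree_lt_degree
    omega
  rw [leadingCoeff_sub_of_degree_lt' hdeg] at h2
  have h3 : 0 < (f ^ 2).leadingCoeff := by
    rw [leadingCoeff_pow]
    have : f.leadingCoeff ≠ 0 := leadingCoeff_ne_zero.2 hf
    positivity
  linarith

variable {N : Type*} [Fintype N] [DecidableEq N]

def MPSD (H : Matrix N N ℝ[X]) : Prop :=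
  H.IsSymm ∧ ∀ x : N → ℝ[X], PolyNonneg (x ⬝ᵥ H *ᵥ x)

lemma quad_congr {R : Type*} [CommRing R] (H C : Matrix N N R) (x : N → R) :
    x ⬝ᵥ (Cᵀ * H * C) *ᵥ x = (C *ᵥ x) ⬝ᵥ H *ᵥ (C *ᵥ x) := by
  rw [← mulVec_mulVec, ← mulVec_mulVec, dotProduct_mulVec, vecMul_transpose]

lemma symm_congr {R : Type*} [CommRing R] {H : Matrix N N R} (h : H.IsSymm) (C : Matrix N N R) :
    (Cᵀ * H * C).IsSymm := by
  unfold Matrix.IsSymm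
  rw [transpose_mul, transpose_mul, transpose_transpose, h.eq, Matrix.mul_assoc]

lemma MPSD.congr {H : Matrix N N ℝ[X]} (h : MPSD H) (C : Matrix N N ℝ[X]) :
    MPSD (Cᵀ * H * C) :=
  ⟨symm_congr h.1 C, fun x => by rw [quad_congr]; exact h.2 _⟩

lemma MPSD.of_congr {H C : Matrix N N ℝ[X]} (hs : H.IsSymm) (hC : C.det ≠ 0)
    (h : MPSD (Cᵀ * H * C)) : MPSD H := by
  refine ⟨hs, fun x => ?_⟩
  apply PolyNonneg.of_sq_mul hC
  have := h.2 (C.adjugate *ᵥ x)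
  rw [quad_congr, mulVec_mulVec, mul_adjugate, smul_mulVec, one_mulVec, mulVec_smul,
    dotProduct_smul, smul_dotProduct, smul_eq_mul, smul_eq_mul] at this
  rwa [sq, mul_assoc]

/-- The matrix with column `i` replaced. -/
lemma det_updateCol_one {R : Type*} [CommRing R] (i : N) (u : N → R) :
    ((1 : Matrix N N R).updateCol i u).det = u i := by
  rw [← cramer_apply, cramer_one]; rfl

lemma updateCol_one_mulVec_single {R : Type*} [CommRing R] (i : N) (u : N → R) :
    ((1 : Matrix N N R).updateCol i u).col i = u := by
  ext j; simp

lemma congr_apply {R : Type*} [CommRing R] (H E : Matrix N N R) (k i : N) :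
    (Eᵀ * H * E) k i = (E.col k) ⬝ᵥ H *ᵥ (E.col i) := by
  rw [Matrix.mul_assoc, mul_apply]
  rfl

section hom
variable {R K : Type*} [CommRing R] [Field K] (φ : R →+* K)

lemma exists_lift_col (hφ : Function.Surjective φ) (H : Matrix N N R) (v : N → K)
    (hv : (H.map φ) *ᵥ v = 0) (i : N) (hi : v i ≠ 0) :
    ∃ u : N → R, u i = 1 ∧ ∀ k, φ ((H *ᵥ u) k) = 0 := by
  choose g hg using hφ
  refine ⟨Function.update (fun k => g ((v i)⁻¹ * v k)) i 1, by simp, fun k => ?_⟩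
  have h1 : (fun k => φ (Function.update (fun k => g ((v i)⁻¹ * v k)) i 1 k)) = (v i)⁻¹ • v := by
    ext k
    by_cases hk : k = i
    · subst hk; simp [hi]
    · simp [hk, hg]
  rw [RingHom.map_mulVec]
  have h2 : (H.map φ) *ᵥ ((v i)⁻¹ • v) = 0 := by rw [mulVec_smul, hv, smul_zero]
  rw [← h1] at h2
  exact congrFun h2 k

lemma ker_congr (H E : Matrix N N R) (i : N) (h : ∀ k, φ ((H *ᵥ (E.col i)) k) = 0) (k : N) :
    φ ((Eᵀ * H * E) k i) = 0 := by
  rw [congr_apply, dotProduct, map_sum]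
  apply Finset.sum_eq_zero
  intro l _
  rw [map_mul, h, mul_zero]

lemma pick (hφ : Function.Surjective φ) (H : Matrix N N R) (hH : φ H.det = 0) :
    ∃ (E : Matrix N N R) (i : N), E.det = 1 ∧ ∀ k, φ ((Eᵀ * H * E) k i) = 0 := by
  have h0 : (H.map φ).det = 0 := by rw [← hH]; exact (RingHom.map_det φ H).symm
  obtain ⟨v, hv0, hv⟩ := exists_mulVec_eq_zero_iff.2 h0
  obtain ⟨i, hi⟩ := Function.ne_iff.1 hv0
  obtain ⟨u, hu1, hu⟩ := exists_lift_col φ hφ H v hv i hi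
  refine ⟨(1 : Matrix N N R).updateCol i u, i, by rw [det_updateCol_one, hu1], fun k => ?_⟩
  apply ker_congr
  rwa [updateCol_one_mulVec_single]

end hom

lemma reduce {R : Type*} [CommRing R] [IsDomain R] (p : R) (H : Matrix N N R) (hs : H.IsSymm)
    (i : N) (h : ∀ k, p ∣ H k i) (hii : p ^ 2 ∣ H i i) :
    ∃ H' C : Matrix N N R, H'.IsSymm ∧ H = Cᵀ * H' * C ∧ C.det = p := by
  choose z hz using h
  obtain ⟨c, hc⟩ := hii
  refine ⟨of fun j k => if j = i then (if k = i then c else z k) else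
    (if k = i then z j else H j k), diagonal (Function.update 1 i p), ?_, ?_, ?_⟩
  · ext j k
    have := hs.apply j k
    simp only [transpose_apply, of_apply]
    split_ifs <;> simp_all
  · ext j k
    rw [diagonal_transpose, mul_diagonal, diagonal_mul]
    have h1 := hs.apply j k
    have h2 := hs.apply i k
    have h3 := hz j
    have h4 := hz k
    by_cases hj : j = i <;> by_cases hk : k = i
    · subst hj; subst hk; simp [hc]; ring
    · subst hj; simp [hk]; rw [← h4, ← h1]
    · subst hk; simp [hj]; rw [h3]; ring
    · simp [hj, hk]
  · rw [det_diagonal, Finset.prod_update_of_mem (Finset.mem_univ i)]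
    simp

lemma complex_step {R : Type*} [CommRing R] [IsDomain R] (φ : R →+* ℂ)
    (hφ : Function.Surjective φ) (p : R) (hp : p ≠ 0) (hker : ∀ g, φ g = 0 ↔ p ∣ g)
    (H : Matrix N N R) (hs : H.IsSymm) (hdet : p ^ 2 ∣ H.det) :
    ∃ (E : Matrix N N R) (i : N), E.det = 1 ∧ (∀ k, p ∣ (Eᵀ * H * E) k i) ∧
      p ^ 2 ∣ (Eᵀ * H * E) i i := by
  have hp0 : φ p = 0 := (hker p).2 dvd_rfl
  obtain ⟨E, i, hE, hEi⟩ := pick φ hφ H ((hker _).2 ((dvd_pow_self p two_ne_zero).trans hdet))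
  have hdet1 : (Eᵀ * H * E).det = H.det := by simp [hE]
  have hs1 := symm_congr hs E
  obtain ⟨H1, hH1⟩ : ∃ H1, H1 = Eᵀ * H * E := ⟨_, rfl⟩
  rw [← hH1] at hEi hdet1 hs1
  have hEi' := fun k => (hker _).1 (hEi k)
  choose y hy using hEi'
  by_cases hyi : φ (y i) = 0
  · refine ⟨E, i, hE, ?_, ?_⟩
    · intro k; rw [← hH1, hy]; exact dvd_mul_right _ _
    · rw [← hH1, hy]
      obtain ⟨c, hc⟩ := (hker _).1 hyi
      exact ⟨c, by rw [hc]; ring⟩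
  have hM : φ (H1.updateCol i y).det = 0 := by
    have : H1.det = p * (H1.updateCol i y).det := by
      rw [← det_updateCol_smul]
      congr 1
      ext a b
      by_cases hb : b = i
      · subst hb; simp [hy]
      · simp [hb]
    rw [← hdet1, this, sq] at hdet
    exact (hker _).2 ((mul_dvd_mul_iff_left hp).1 hdet)
  have hM' : ((H1.updateCol i y).map φ).det = 0 := by
    rw [← hM]; exact (RingHom.map_det φ _).symm
  obtain ⟨w, hw0, hw⟩ := exists_mulVec_eq_zero_iff.2 hM'
  have hwi : w i = 0 := by
    have := congrFun hw i
    rw [mulVec, dotProduct, Finset.sum_eq_single i] at this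
    · simpa [hyi] using this
    · intro b _ hb
      simp [hb]
      left
      rw [← hs1.apply, hEi]
    · simp
  have hw1 : (H1.map φ) *ᵥ w = 0 := by
    rw [← hw]
    ext a
    simp only [mulVec, dotProduct]
    apply Finset.sum_congr rfl
    intro b _
    by_cases hb : b = i
    · subst hb; simp [hwi]
    · simp [hb]
  obtain ⟨j, hj⟩ := Function.ne_iff.1 hw0
  have hji : j ≠ i := by rintro rfl; exact hj hwi
  obtain ⟨u, hu1, hu⟩ := exists_lift_col φ hφ H1 w hw1 j hj
  obtain ⟨E', hE'⟩ : ∃ E', E' = (1 : Matrix N N R).updateCol j u := ⟨_, rfl⟩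
  have hE'd : E'.det = 1 := by rw [hE', det_updateCol_one, hu1]
  have hs2 := symm_congr hs1 E'
  have hcj : ∀ k, φ ((E'ᵀ * H1 * E') k j) = 0 := by
    apply ker_congr
    rwa [hE', updateCol_one_mulVec_single]
  have hci : ∀ k, φ ((E'ᵀ * H1 * E') k i) = 0 := by
    apply ker_congr
    intro k
    have : E'.col i = Pi.single i 1 := by
      ext k
      simp [hE', hji.symm, one_apply, Pi.single_apply]
    rw [this]
    simp [hEi]
  have hH2 : E'ᵀ * H1 * E' = (E * E')ᵀ * H * (E * E') := by
    rw [hH1, transpose_mul]; simp only [Matrix.mul_assoc]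
  have hdet2 : (E * E').det = 1 := by simp [hE, hE'd]
  obtain ⟨H2, hH2'⟩ : ∃ H2, H2 = E'ᵀ * H1 * E' := ⟨_, rfl⟩
  rw [← hH2'] at hs2 hcj hci hH2
  obtain ⟨a, ha⟩ := (hker _).1 (hci i)
  obtain ⟨b, hb⟩ := (hker _).1 (hcj i)
  obtain ⟨c, hc⟩ := (hker _).1 (hcj j)
  by_cases hc0 : φ c = 0
  · refine ⟨E * E', j, hdet2, ?_, ?_⟩
    · intro k; rw [← hH2]; exact (hker _).1 (hcj k)
    · rw [← hH2, hc]
      obtain ⟨c', hc'⟩ := (hker _).1 hc0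
      exact ⟨c', by rw [hc']; ring⟩
  obtain ⟨y0, hy0⟩ : ∃ y0 : ℂ, φ c * (y0 * y0) + (2 * φ b) * y0 + φ a = 0 := by
    apply exists_quadratic_eq_zero hc0
    obtain ⟨s, hs⟩ := IsAlgClosed.exists_pow_nat_eq (discrim (φ c) (2 * φ b) (φ a)) two_pos
    exact ⟨s, by rw [← hs, sq]⟩
  obtain ⟨y1, rfl⟩ := hφ y0
  obtain ⟨u3, hu3⟩ : ∃ u3 : N → R, u3 = Pi.single i 1 + y1 • Pi.single j 1 := ⟨_, rfl⟩
  have hu3H : H2 *ᵥ u3 = fun k => H2 k i + y1 * H2 k j := by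
    rw [hu3, mulVec_add, mulVec_smul]
    ext k
    simp
  obtain ⟨E3, hE3⟩ : ∃ E3, E3 = (1 : Matrix N N R).updateCol i u3 := ⟨_, rfl⟩
  have hE3d : E3.det = 1 := by rw [hE3, det_updateCol_one, hu3]; simp [hji.symm]
  have hE3c : E3.col i = u3 := by rw [hE3, updateCol_one_mulVec_single]
  have hH3 : (E * E' * E3)ᵀ * H * (E * E' * E3) = E3ᵀ * H2 * E3 := by
    rw [hH2]; simp only [transpose_mul, Matrix.mul_assoc]
  refine ⟨E * E' * E3, i, by rw [det_mul, hdet2, hE3d, one_mul], ?_, ?_⟩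
  · intro k
    rw [hH3, ← hker]
    apply ker_congr
    intro k
    rw [hE3c, hu3H]
    simp [hci, hcj]
  · rw [hH3, congr_apply, hE3c, hu3H]
    have : u3 ⬝ᵥ (fun k => H2 k i + y1 * H2 k j) = p * (c * (y1 * y1) + (2 * b) * y1 + a) := by
      have hji' : H2 j i = p * b := by rw [← hb]; exact hs2.apply i j
      rw [hu3, add_dotProduct, smul_dotProduct]
      simp [ha, hb, hc, hji']
      ring
    rw [this, sq]
    apply mul_dvd_mul_left
    rw [← hker]
    simpa [map_ofNat] using hy0
end

section
open Polynomial Matrix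
set_option linter.unusedSectionVars false
variable {N : Type*} [Fintype N] [DecidableEq N]

lemma coeff_prod_top {ι : Type*} (s : Finset ι) (f : ι → ℝ[X]) (a : ι → ℕ)
    (h : ∀ i ∈ s, (f i).natDegree ≤ a i) :
    (∏ i ∈ s, f i).natDegree ≤ ∑ i ∈ s, a i ∧
    (∏ i ∈ s, f i).coeff (∑ i ∈ s, a i) = ∏ i ∈ s, (f i).coeff (a i) := by
  classical
  induction s using Finset.induction_on with
  | empty => simp
  | insert i s hi ih =>
    have h1 := ih (fun j hj => h j (Finset.mem_insert_of_mem hj))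
    have h2 := h i (Finset.mem_insert_self i s)
    rw [Finset.prod_insert hi, Finset.sum_insert hi, Finset.prod_insert hi]
    refine ⟨natDegree_mul_le.trans (add_le_add h2 h1.1), ?_⟩
    rw [coeff_mul_add_eq_of_natDegree_le h2 h1.1, h1.2]

lemma det_coeff_top (K : Matrix N N ℝ[X]) (a : N → ℕ)
    (h : ∀ i j, (K i j).natDegree ≤ a i + a j) :
    K.det.coeff (∑ i, (a i + a i)) = (of fun i j => (K i j).coeff (a i + a j)).det := by
  rw [det_apply, det_apply, finsetSum_coeff]
  apply Finset.sum_congr rfl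
  intro σ _
  have h1 : ∑ i, (a i + a i) = ∑ i, (a (σ i) + a i) := by
    rw [Finset.sum_add_distrib, Finset.sum_add_distrib, Equiv.sum_comp σ a]
  rw [h1, coeff_smul, (coeff_prod_top Finset.univ (fun i => K (σ i) i) _ (fun i _ => h _ _)).2]
  rfl

lemma MPSD.diag {K : Matrix N N ℝ[X]} (h : MPSD K) (i : N) : PolyNonneg (K i i) := by
  have := h.2 (Pi.single i 1)
  simpa using this

lemma MPSD.minor {K : Matrix N N ℝ[X]} (h : MPSD K) (i j : N) (hj : K j j ≠ 0) :
    PolyNonneg (K i i * K j j - K i j ^ 2) := by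
  by_cases hij : i = j
  · subst hij
    intro t
    simp [sq]
  apply PolyNonneg.of_sq_mul hj
  have h1 := h.2 (K j j • Pi.single i 1 - K i j • Pi.single j 1)
  have hs : K j i = K i j := h.1.apply i j
  have h2 : (K j j • Pi.single i 1 - K i j • Pi.single j 1 : N → ℝ[X]) ⬝ᵥ
      K *ᵥ (K j j • Pi.single i 1 - K i j • Pi.single j 1) =
      K j j * (K i i * K j j - K i j ^ 2) := by
    rw [mulVec_sub, mulVec_smul, mulVec_smul]
    simp [sub_dotProduct, hs]
    ring
  rw [h2] at h1
  intro t
  have h3 := h1 t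
  have h4 := h.diag j t
  rw [sq, mul_assoc, eval_mul]
  exact mul_nonneg h4 h3

lemma MPSD.diag_ne {K : Matrix N N ℝ[X]} (h : MPSD K) (hd : K.det ≠ 0) (i : N) : K i i ≠ 0 := by
  intro h0
  apply hd
  have hz : ∀ j, K i j = 0 := by
    intro j
    by_cases hj : K j j = 0
    · skip
      by_cases hij : i = j
      · subst hij; exact h0
      have hs : K j i = K i j := h.1.apply i j
      have h1 := h.2 (Pi.single i 1 + Pi.single j 1)
      have h2 := h.2 (Pi.single i 1 - Pi.single j 1)
      rw [mulVec_add] at h1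
      rw [mulVec_sub] at h2
      simp [add_dotProduct, sub_dotProduct, h0, hj, hs] at h1 h2
      apply Polynomial.funext
      intro t
      have h3 := h1 t
      have h4 := h2 t
      simp at h3 h4 ⊢
      linarith
    · have h1 := h.minor i j hj
      rw [h0] at h1
      apply Polynomial.funext
      intro t
      have h2 := h1 t
      simp at h2 ⊢
      nlinarith
  exact det_eq_zero_of_row_eq_zero i hz

lemma fact_of_congr {H E B : Matrix N N ℝ[X]} (hE : IsUnit E.det)
    (h : Eᵀ * H * E = Bᵀ * B) : ∃ B' : Matrix N N ℝ[X], H = B'ᵀ * B' := by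
  refine ⟨B * E⁻¹, ?_⟩
  rw [transpose_mul, Matrix.mul_assoc, ← Matrix.mul_assoc Bᵀ, ← h]
  have h1 : E * E⁻¹ = 1 := mul_nonsing_inv E hE
  have h2 : (E⁻¹)ᵀ * Eᵀ = 1 := by rw [← transpose_mul, h1, transpose_one]
  calc H = ((E⁻¹)ᵀ * Eᵀ) * H * (E * E⁻¹) := by rw [h1, h2]; simp
    _ = _ := by simp only [Matrix.mul_assoc]

open scoped MatrixOrder in
lemma const_fact (K : Matrix N N ℝ[X]) (h : MPSD K) (h0 : ∀ i j, (K i j).natDegree = 0) :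
    ∃ B : Matrix N N ℝ[X], K = Bᵀ * B := by
  obtain ⟨K0, hK0⟩ : ∃ K0 : Matrix N N ℝ, K0 = of fun i j => (K i j).coeff 0 := ⟨_, rfl⟩
  have hK : K = K0.map C := by
    ext1 i j
    rw [hK0]
    exact eq_C_of_natDegree_eq_zero (h0 i j)
  have hps : K0.PosSemidef := by
    refine PosSemidef.of_dotProduct_mulVec_nonneg ?_ ?_
    · ext i j
      have := h.1.apply i j
      simp [hK0, this]
    · intro x
      have h1 := h.2 (fun i => C (x i)) 0
      have h2 : (fun i => C (x i)) ⬝ᵥ K *ᵥ (fun i => C (x i)) = C (x ⬝ᵥ K0 *ᵥ x) := by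
        rw [hK]
        simp [dotProduct, mulVec]
      rw [h2] at h1
      simpa using h1
  obtain ⟨B, hB⟩ := CStarAlgebra.nonneg_iff_eq_star_mul_self.mp hps.nonneg
  refine ⟨B.map C, ?_⟩
  rw [hK, hB, Matrix.map_mul]
  rfl

lemma harder (n : ℕ) : ∀ K : Matrix N N ℝ[X], MPSD K → IsUnit K.det →
    ∑ i, (K i i).natDegree = n → ∃ B : Matrix N N ℝ[X], K = Bᵀ * B := by
  induction n using Nat.strong_induction_on with
  | _ n ih =>
  intro K hK hdet hn
  have hdet0 : K.det ≠ 0 := hdet.ne_zero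
  have hev := fun i => (hK.diag i).even
  choose a ha using hev
  have hne := hK.diag_ne hdet0
  have hbd : ∀ i j, (K i j).natDegree ≤ a i + a j := by
    intro i j
    have := (hK.minor i j (hne j)).degree_le
    rw [natDegree_mul (hne i) (hne j), ha, ha] at this
    omega
  by_cases hL : (of fun i j => (K i j).coeff (a i + a j) : Matrix N N ℝ).det = 0
  · obtain ⟨v, hv0, hv⟩ := exists_mulVec_eq_zero_iff.2 hL
    have hsupp : (Finset.univ.filter (fun i => v i ≠ 0)).Nonempty := by
      obtain ⟨i, hi⟩ := Function.ne_iff.1 hv0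
      exact ⟨i, by simpa using hi⟩
    obtain ⟨i, hi, hmax⟩ := Finset.exists_max_image _ a hsupp
    simp only [Finset.mem_filter, Finset.mem_univ, true_and] at hi hmax
    obtain ⟨u, hu⟩ : ∃ u : N → ℝ[X], u = fun j => C (v j) * X ^ (a i - a j) := ⟨_, rfl⟩
    obtain ⟨E, hE⟩ : ∃ E, E = (1 : Matrix N N ℝ[X]).updateCol i u := ⟨_, rfl⟩
    have hEd : IsUnit E.det := by
      rw [hE, det_updateCol_one, hu]
      simpa using hi
    have hEi : E.col i = u := by rw [hE, updateCol_one_mulVec_single]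
    have hEj : ∀ j, j ≠ i → E.col j = Pi.single j 1 := by
      intro j hj
      ext k
      simp [hE, hj, one_apply, Pi.single_apply]
    have hK' := hK.congr E
    have hdet' : IsUnit (Eᵀ * K * E).det := by
      rw [det_mul, det_mul, det_transpose]
      exact (hEd.mul hdet).mul hEd
    have hjj : ∀ j, j ≠ i → (Eᵀ * K * E) j j = K j j := by
      intro j hj
      rw [congr_apply, hEj j hj]
      simp
    have hterm : ∀ j k, (u j * (K j k * u k)).natDegree ≤ a i + a i ∧
        (u j * (K j k * u k)).coeff (a i + a i) = v j * ((K j k).coeff (a j + a k) * v k) := by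
      intro j k
      by_cases hj : v j = 0
      · simp [hu, hj]
      by_cases hk : v k = 0
      · simp [hu, hk]
      have h1 := hmax j hj
      have h2 := hmax k hk
      have h3 : u j * (K j k * u k) = C (v j * v k) * (K j k * X ^ ((a i - a j) + (a i - a k))) := by
        rw [hu, pow_add, C_mul]; ring
      rw [h3]
      have h4 := hbd j k
      constructor
      · refine (natDegree_C_mul_le _ _).trans ?_
        refine natDegree_mul_le.trans ?_
        rw [natDegree_X_pow]
        omega
      · have h5 : a i + a i = (a j + a k) + ((a i - a j) + (a i - a k)) := by omega
        rw [coeff_C_mul, h5, coeff_mul_X_pow]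
        ring
    have hii : (Eᵀ * K * E) i i = ∑ j, ∑ k, u j * (K j k * u k) := by
      rw [congr_apply, hEi]
      simp [dotProduct, mulVec, Finset.mul_sum]
    have hdeg : ((Eᵀ * K * E) i i).natDegree ≤ a i + a i := by
      rw [hii]
      exact natDegree_sum_le_of_forall_le _ _ fun j _ =>
        natDegree_sum_le_of_forall_le _ _ fun k _ => (hterm j k).1
    have hcoef : ((Eᵀ * K * E) i i).coeff (a i + a i) = 0 := by
      rw [hii, finsetSum_coeff]
      have h1 : v ⬝ᵥ ((of fun i j => (K i j).coeff (a i + a j) : Matrix N N ℝ) *ᵥ v) = 0 := by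
        rw [hv, dotProduct_zero]
      rw [← h1]
      simp only [finsetSum_coeff, (hterm _ _).2, dotProduct, mulVec, Finset.mul_sum, of_apply]
    have hne' := hK'.diag_ne hdet'.ne_zero i
    have hlt : ((Eᵀ * K * E) i i).natDegree < (K i i).natDegree := by
      rw [ha]
      refine lt_of_le_of_ne hdeg fun h => ?_
      rw [← h] at hcoef
      exact hne' (leadingCoeff_eq_zero.1 hcoef)
    obtain ⟨B, hB⟩ := ih (∑ j, ((Eᵀ * K * E) j j).natDegree) (by
      rw [← hn]
      apply Finset.sum_lt_sum
      · intro j _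
        by_cases hj : j = i
        · subst hj; exact hlt.le
        · rw [hjj j hj]
      · exact ⟨i, Finset.mem_univ i, hlt⟩) _ hK' hdet' rfl
    exact fact_of_congr hEd hB
  · rw [← det_coeff_top K a hbd] at hL
    have h1 := le_natDegree_of_ne_zero hL
    rw [natDegree_eq_zero_of_isUnit hdet] at h1
    have h2 : ∀ i, a i + a i = 0 := by
      intro i
      have := Finset.single_le_sum (f := fun i => a i + a i) (fun _ _ => Nat.zero_le _)
        (Finset.mem_univ i)
      have h3 : a i + a i ≤ ∑ i, (a i + a i) := this
      omega
    apply const_fact K hK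
    intro i j
    have := hbd i j
    have h3 := h2 i
    have h4 := h2 j
    omega

lemma aeval_surj (z : ℂ) (hz : z.im ≠ 0) : Function.Surjective (aeval z : ℝ[X] →ₐ[ℝ] ℂ) := by
  intro w
  refine ⟨C (w.re - w.im / z.im * z.re) + C (w.im / z.im) * X, ?_⟩
  apply Complex.ext
  · simp
  · simp [hz]

lemma exists_reduction (H : Matrix N N ℝ[X]) (hH : MPSD H) (hsq : IsSquare H.det)
    (hd : H.det.natDegree ≠ 0) :
    ∃ (p : ℝ[X]) (E : Matrix N N ℝ[X]) (i : N), 0 < p.natDegree ∧ E.det = 1 ∧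
      (∀ k, p ∣ (Eᵀ * H * E) k i) ∧ p ^ 2 ∣ (Eᵀ * H * E) i i := by
  obtain ⟨z, hz⟩ := IsAlgClosed.exists_aeval_eq_zero ℂ H.det (by
    intro h; exact hd (natDegree_eq_of_degree_eq_some h))
  by_cases him : z.im = 0
  · have hre : z = ((z.re : ℝ) : ℂ) := by apply Complex.ext <;> simp [him]
    obtain ⟨t, ht⟩ : ∃ t : ℝ, t = z.re := ⟨_, rfl⟩
    have h0 : H.det.eval t = 0 := by
      rw [hre, ← ht] at hz
      have : aeval ((algebraMap ℝ ℂ) t) H.det = 0 := hz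
      rw [aeval_algebraMap_apply] at this
      simpa using this
    obtain ⟨E, i, hE, hEi⟩ := pick (evalRingHom t) (fun w => ⟨C w, by simp⟩) H (by simpa using h0)
    refine ⟨X - C t, E, i, by simp, hE, ?_, ?_⟩
    · intro k
      exact dvd_iff_isRoot.2 (hEi k)
    · exact ((hH.congr E).diag i).sq_dvd (hEi i)
  · have hint : IsIntegral ℝ z := Algebra.IsIntegral.isIntegral z
    have hker : ∀ g : ℝ[X], aeval z g = 0 ↔ minpoly ℝ z ∣ g := fun g => (minpoly.dvd_iff).symm
    have hp := minpoly.prime hint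
    have hdvd : (minpoly ℝ z) ^ 2 ∣ H.det := by
      obtain ⟨g, hg⟩ := hsq
      have h1 := (hker _).1 hz
      rw [hg] at h1 ⊢
      rw [sq]
      have h2 : minpoly ℝ z ∣ g := (hp.dvd_or_dvd h1).elim id id
      exact mul_dvd_mul h2 h2
    obtain ⟨E, i, h1, h2, h3⟩ := complex_step (aeval z : ℝ[X] →ₐ[ℝ] ℂ).toRingHom (aeval_surj z him)
      (minpoly ℝ z) hp.ne_zero hker H hH.1 hdvd
    exact ⟨_, E, i, minpoly.natDegree_pos hint, h1, h2, h3⟩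

lemma square_fact (n : ℕ) : ∀ H : Matrix N N ℝ[X], MPSD H → IsSquare H.det → H.det ≠ 0 →
    H.det.natDegree = n → ∃ B : Matrix N N ℝ[X], H = Bᵀ * B := by
  induction n using Nat.strong_induction_on with
  | _ n ih =>
  intro H hH hsq hne hn
  by_cases hd : H.det.natDegree = 0
  · refine harder _ H hH ?_ rfl
    rw [isUnit_iff_degree_eq_zero, degree_eq_natDegree hne, hd]; rfl
  obtain ⟨p, E, i, hp, hE, h1, h2⟩ := exists_reduction H hH hsq hd
  obtain ⟨H', D, hs, hHD, hD⟩ := reduce p _ (symm_congr hH.1 E) i h1 h2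
  have hp0 : p ≠ 0 := by rintro rfl; simp at hp
  have hH' : MPSD H' := MPSD.of_congr hs (by rw [hD]; exact hp0) (by rw [← hHD]; exact hH.congr E)
  have hdet : H.det = p ^ 2 * H'.det := by
    have := congrArg Matrix.det hHD
    rw [det_mul, det_mul, det_mul, det_mul, det_transpose, det_transpose, hE, hD] at this
    linear_combination this
  have hne' : H'.det ≠ 0 := by
    intro h; apply hne; rw [hdet, h, mul_zero]
  obtain ⟨B, hB⟩ := ih H'.det.natDegree (by
    rw [← hn, hdet, natDegree_mul (pow_ne_zero _ hp0) hne', natDegree_pow]; omega) H' hH' (by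
    obtain ⟨g, hg⟩ := hsq
    have h3 : p ^ 2 ∣ g ^ 2 := ⟨H'.det, by rw [← hdet, hg, sq]⟩
    obtain ⟨q, rfl⟩ := (IsIntegrallyClosed.pow_dvd_pow_iff two_ne_zero).1 h3
    refine ⟨q, mul_left_cancel₀ (pow_ne_zero 2 hp0) ?_⟩
    rw [← hdet, hg]; ring) hne' rfl
  apply fact_of_congr (E := E) (B := B * D) (by rw [hE]; exact isUnit_one)
  rw [hHD, hB, transpose_mul]
  simp only [Matrix.mul_assoc]

lemma sum_sq_zero {ι : Type*} (s : Finset ι) (f : ι → ℝ[X]) (h : ∑ i ∈ s, f i * f i = 0) :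
    ∀ i ∈ s, f i = 0 := by
  intro i hi
  apply Polynomial.funext
  intro t
  have h1 := congrArg (eval t) h
  rw [eval_finsetSum, eval_zero, Finset.sum_eq_zero_iff_of_nonneg] at h1
  · simpa using h1 i hi
  · intro j _
    rw [eval_mul]; exact mul_self_nonneg _

lemma gram_quad {M : Type*} [Fintype M] (A : Matrix M N ℝ[X]) (x : N → ℝ[X]) :
    x ⬝ᵥ (Aᵀ * A) *ᵥ x = ∑ i, (A *ᵥ x) i * (A *ᵥ x) i := by
  rw [← mulVec_mulVec, dotProduct_mulVec, vecMul_transpose]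
  rfl

lemma gram_indep {M : Type*} [Fintype M] (A : Matrix M N ℝ[X])
    (hA : ∀ x, A *ᵥ x = 0 → x = 0) :
    ∃ B : Matrix (N ⊕ Unit) N ℝ[X], Aᵀ * A = Bᵀ * B := by
  have hdet : (Aᵀ * A).det ≠ 0 := by
    intro h
    obtain ⟨v, hv0, hv⟩ := exists_mulVec_eq_zero_iff.2 h
    apply hv0
    apply hA
    have h1 := gram_quad A v
    rw [hv, dotProduct_zero] at h1
    ext1 i
    exact sum_sq_zero _ _ h1.symm i (Finset.mem_univ i)
  have hdetnn : PolyNonneg (Aᵀ * A).det := by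
    intro t
    have h1 : (Aᵀ * A).det.eval t = ((A.map (eval t))ᴴ * A.map (eval t)).det := by
      have := RingHom.map_det (evalRingHom t) (Aᵀ * A)
      rw [coe_evalRingHom] at this
      rw [this]
      congr 1
      ext i j
      simp [mul_apply, eval_finsetSum]
    rw [h1]
    exact (posSemidef_conjTranspose_mul_self _).det_nonneg
  obtain ⟨g, hg⟩ : ∃ g, g = (Aᵀ * A).det := ⟨_, rfl⟩
  obtain ⟨H, hH⟩ : ∃ H : Matrix (N ⊕ Unit) (N ⊕ Unit) ℝ[X],
    H = fromBlocks (Aᵀ * A) 0 0 (of fun _ _ => g) := ⟨_, rfl⟩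
  have hHdet : H.det = g * g := by
    rw [hH, det_fromBlocks_zero₂₁, ← hg]; simp
  rw [← hg] at hdet hdetnn
  have hps : MPSD H := by
    constructor
    · rw [hH]
      apply IsSymm.fromBlocks
      · unfold Matrix.IsSymm; rw [transpose_mul, transpose_transpose]
      · simp
      · ext; rfl
    · intro x t
      have : x ⬝ᵥ H *ᵥ x = (∑ i, (A *ᵥ (x ∘ Sum.inl)) i * (A *ᵥ (x ∘ Sum.inl)) i) +
          g * (x (Sum.inr ()) * x (Sum.inr ())) := by
        rw [← gram_quad, hH, fromBlocks_mulVec]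
        simp [dotProduct, mulVec]
        ring
      rw [this, eval_add, eval_finsetSum, eval_mul]
      apply add_nonneg
      · apply Finset.sum_nonneg
        intro i _
        rw [eval_mul]; exact mul_self_nonneg _
      · refine mul_nonneg (hdetnn t) ?_
        rw [eval_mul]; exact mul_self_nonneg _
  obtain ⟨B, hB⟩ := square_fact _ H hps ⟨g, hHdet⟩ (by rw [hHdet]; exact mul_ne_zero hdet hdet) rfl
  refine ⟨B.submatrix id Sum.inl, ?_⟩
  ext1 i j
  have h1 := congrFun (congrFun hB (Sum.inl i)) (Sum.inl j)
  rw [hH] at h1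
  simpa [mul_apply] using h1

theorem gram_main {r n : ℕ} (A : Matrix (Fin r) (Fin n) ℝ[X]) :
    ∃ B : Matrix (Fin (n + 1)) (Fin n) ℝ[X], Aᵀ * A = Bᵀ * B := by
  obtain ⟨k, b⟩ := Submodule.basisOfPid (Pi.basisFun ℝ[X] (Fin r)) (LinearMap.range A.mulVecLin)
  have hk : k ≤ n := by
    have h1 := Module.finrank_eq_card_basis b
    have h2 := LinearMap.finrank_range_le A.mulVecLin
    rw [h1] at h2
    simpa using h2
  obtain ⟨A', hA'⟩ : ∃ A' : Matrix (Fin r) (Fin k) ℝ[X], A' = of fun i j => (b j : Fin r → ℝ[X]) i :=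
    ⟨_, rfl⟩
  have hmv : ∀ x, A' *ᵥ x = ((∑ j, x j • b j : LinearMap.range A.mulVecLin) : Fin r → ℝ[X]) := by
    intro x
    ext1 i
    simp [hA', mulVec, dotProduct, mul_comm]
  obtain ⟨D, hD⟩ : ∃ D : Matrix (Fin k) (Fin n) ℝ[X], D = of fun j l =>
    b.repr ⟨A *ᵥ Pi.single l 1, ⟨Pi.single l 1, rfl⟩⟩ j := ⟨_, rfl⟩
  have hAD : A = A' * D := by
    ext1 i l
    have h1 := b.sum_repr ⟨A *ᵥ Pi.single l 1, ⟨Pi.single l 1, rfl⟩⟩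
    have h2 := congrFun (hmv (D.col l)) i
    have h3 : (∑ j, D.col l j • b j) = ⟨A *ᵥ Pi.single l 1, ⟨Pi.single l 1, rfl⟩⟩ := by
      rw [← h1]; simp [hD]
    rw [h3] at h2
    simp at h2
    rw [← h2]
    rfl
  obtain ⟨B, hB⟩ := gram_indep A' (by
    intro x hx
    rw [hmv] at hx
    have h1 : (∑ j, x j • b j) = 0 := Subtype.ext hx
    ext1 j
    exact Fintype.linearIndependent_iff.1 b.linearIndependent x h1 j)
  have hG : Aᵀ * A = (B * D)ᵀ * (B * D) := by
    rw [hAD, transpose_mul, Matrix.mul_assoc, ← Matrix.mul_assoc A'ᵀ, hB, transpose_mul]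
    simp only [Matrix.mul_assoc]
  obtain ⟨e⟩ : Nonempty ((Fin k ⊕ Unit) ⊕ Fin (n - k) ≃ Fin (n + 1)) := by
    apply Fintype.card_eq.1
    simp
    omega
  refine ⟨(of fun s j => Sum.elim (fun a => (B * D) a j) (fun _ => 0) s).submatrix e.symm id, ?_⟩
  rw [hG]
  ext1 i j
  simp only [mul_apply, transpose_apply, submatrix_apply, id]
  rw [← Equiv.sum_comp e]
  simp
end

noncomputable section

/-- The images of the three new coordinates: `1`, `s t`, `s`. -/
def leepW : Fin 3 → Polynomial (Polynomial ℝ) :=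
  ![1, Polynomial.X * Polynomial.C Polynomial.X, Polynomial.X]

/-- The image of the `j`-th variable. -/
def leepV (M : Matrix (Fin 3) (Fin 3) ℝ) (j : Fin 3) : Polynomial (Polynomial ℝ) :=
  ∑ k, Polynomial.C (Polynomial.C (M j k)) * leepW k

/-- Restriction of a form to the chart adapted to the basis given by the columns of `M`. -/
def leepPhi (M : Matrix (Fin 3) (Fin 3) ℝ) :
    MvPolynomial (Fin 3) ℝ →ₐ[ℝ] Polynomial (Polynomial ℝ) :=
  MvPolynomial.aeval (leepV M)

lemma leepV_eq (M : Matrix (Fin 3) (Fin 3) ℝ) (j : Fin 3) :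
    leepV M j = Polynomial.C (Polynomial.C (M j 0)) +
      Polynomial.X * Polynomial.C (Polynomial.C (M j 1) * Polynomial.X + Polynomial.C (M j 2)) := by
  simp [leepV, leepW, Fin.sum_univ_three]
  ring

lemma leepPhi_C (M : Matrix (Fin 3) (Fin 3) ℝ) (a : ℝ) :
    leepPhi M (MvPolynomial.C a) = Polynomial.C (Polynomial.C a) := by
  rw [leepPhi, MvPolynomial.aeval_C]; rfl

lemma leepPhi_X (M : Matrix (Fin 3) (Fin 3) ℝ) (j : Fin 3) :
    leepPhi M (MvPolynomial.X j) = leepV M j := by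
  rw [leepPhi, MvPolynomial.aeval_X]

/-- Degree bounds satisfied by the image of a form of degree `d`. -/
def LGood (d : ℕ) (g : Polynomial (Polynomial ℝ)) : Prop :=
  g.natDegree ≤ d ∧ ∀ j, (g.coeff j).natDegree ≤ j

lemma LGood.mul {d e : ℕ} {g h : Polynomial (Polynomial ℝ)} (hg : LGood d g) (hh : LGood e h) :
    LGood (d + e) (g * h) := by
  refine ⟨Polynomial.natDegree_mul_le.trans (add_le_add hg.1 hh.1), fun j => ?_⟩
  rw [Polynomial.coeff_mul]
  apply Polynomial.natDegree_sum_le_of_forall_le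
  rintro ⟨a, b⟩ hab
  have hab : a + b = j := by simpa using hab
  rw [← hab]
  exact Polynomial.natDegree_mul_le.trans (add_le_add (hg.2 a) (hh.2 b))

lemma LGood.sum {ι : Type*} {d : ℕ} (s : Finset ι) (g : ι → Polynomial (Polynomial ℝ))
    (h : ∀ i ∈ s, LGood d (g i)) : LGood d (∑ i ∈ s, g i) := by
  refine ⟨Polynomial.natDegree_sum_le_of_forall_le _ _ fun i hi => (h i hi).1, fun j => ?_⟩
  rw [Polynomial.finsetSum_coeff]
  exact Polynomial.natDegree_sum_le_of_forall_le _ _ fun i hi => (h i hi).2 j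

lemma LGood.const (a : ℝ) : LGood 0 (Polynomial.C (Polynomial.C a)) := by
  refine ⟨by simp, fun j => ?_⟩
  rw [Polynomial.coeff_C]
  split_ifs <;> simp

lemma LGood.pow {d : ℕ} {g : Polynomial (Polynomial ℝ)} (h : LGood d g) (n : ℕ) :
    LGood (n * d) (g ^ n) := by
  induction n with
  | zero => simpa using LGood.const 1
  | succ n ih => rw [pow_succ, Nat.succ_mul]; exact ih.mul h

lemma leepV_good (M : Matrix (Fin 3) (Fin 3) ℝ) (j : Fin 3) : LGood 1 (leepV M j) := by
  rw [leepV_eq]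
  constructor
  · compute_degree
  · intro k
    rcases k with _ | _ | k
    · simp
    · simp [Polynomial.coeff_C]
      compute_degree
    · simp [Polynomial.coeff_C]

lemma leepPhi_good (M : Matrix (Fin 3) (Fin 3) ℝ) {d : ℕ} {p : MvPolynomial (Fin 3) ℝ}
    (hp : p.IsHomogeneous d) : LGood d (leepPhi M p) := by
  rw [leepPhi, MvPolynomial.aeval_def, MvPolynomial.eval₂_eq']
  apply LGood.sum
  intro e he
  have hd : e 0 + e 1 + e 2 = d := by
    have := hp (MvPolynomial.mem_support_iff.1 he)
    rw [← this, Finsupp.weight_apply, Finsupp.sum_fintype _ _ (by simp)]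
    simp [Fin.sum_univ_three]
  rw [Fin.prod_univ_three]
  have h := (LGood.const (MvPolynomial.coeff e p)).mul
    ((((leepV_good M 0).pow (e 0)).mul ((leepV_good M 1).pow (e 1))).mul
      ((leepV_good M 2).pow (e 2)))
  have h2 : 0 + (e 0 * 1 + e 1 * 1 + e 2 * 1) = d := by omega
  rw [h2] at h
  exact h

lemma leepPhi_derivative (M : Matrix (Fin 3) (Fin 3) ℝ) (f : MvPolynomial (Fin 3) ℝ) :
    Polynomial.derivative (leepPhi M f) = ∑ j, Polynomial.C (Polynomial.C (M j 1) * Polynomial.X +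
      Polynomial.C (M j 2)) * leepPhi M (MvPolynomial.pderiv j f) := by
  induction f using MvPolynomial.induction_on with
  | C a => simp [leepPhi_C]
  | add p q hp hq =>
    simp only [map_add, hp, hq, mul_add, Finset.sum_add_distrib]
  | mul_X p n hp =>
    have hX : Polynomial.derivative (leepV M n) =
        Polynomial.C (Polynomial.C (M n 1) * Polynomial.X + Polynomial.C (M n 2)) := by
      rw [leepV_eq]; simp
    rw [map_mul, leepPhi_X, Polynomial.derivative_mul, hp, hX]
    generalize hc : (fun j : Fin 3 => Polynomial.C (Polynomial.C (M j 1) * Polynomial.X +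
      Polynomial.C (M j 2))) = c
    have hc' : ∀ j, Polynomial.C (Polynomial.C (M j 1) * Polynomial.X +
      Polynomial.C (M j 2)) = c j := fun j => by rw [← hc]
    have h1 : ∀ j, c j * leepPhi M (MvPolynomial.pderiv j (p * MvPolynomial.X n)) =
        c j * leepPhi M (MvPolynomial.pderiv j p) * leepV M n +
          (if n = j then c j * leepPhi M p else 0) := by
      intro j
      rw [MvPolynomial.pderiv_mul, MvPolynomial.pderiv_X, map_add, map_mul, leepPhi_X]
      by_cases h : n = j
      · subst h
        rw [Pi.single_eq_same, mul_one, if_pos rfl]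
        ring
      · rw [Pi.single_eq_of_ne h, mul_zero, map_zero, if_neg h]
        ring
    simp only [hc']
    rw [Finset.sum_congr rfl (fun j _ => h1 j), Finset.sum_add_distrib, ← Finset.sum_mul,
      Finset.sum_ite_eq, if_pos (Finset.mem_univ n)]
    ring

lemma leepPhi_coeff_zero (M : Matrix (Fin 3) (Fin 3) ℝ) (f : MvPolynomial (Fin 3) ℝ) :
    (leepPhi M f).coeff 0 = Polynomial.C (MvPolynomial.eval (fun j => M j 0) f) := by
  induction f using MvPolynomial.induction_on with
  | C a => simp [leepPhi_C]
  | add p q hp hq => simp [hp, hq]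
  | mul_X p n hp =>
    rw [map_mul, leepPhi_X, Polynomial.mul_coeff_zero, hp, leepV_eq]
    simp

lemma leep_vanish (M : Matrix (Fin 3) (Fin 3) ℝ) (K : ℕ) : ∀ f : MvPolynomial (Fin 3) ℝ,
    (∀ l : List (Fin 3), l.length < K →
      MvPolynomial.eval (fun j => M j 0) (iteratedPDeriv l f) = 0) →
    Polynomial.X ^ K ∣ leepPhi M f := by
  induction K with
  | zero => intro f _; simp
  | succ K ih =>
    intro f hf
    have h1 : ∀ j, Polynomial.X ^ K ∣ leepPhi M (MvPolynomial.pderiv j f) := by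
      intro j
      apply ih
      intro l hl
      exact hf (j :: l) (by simpa using hl)
    have h2 : Polynomial.X ^ K ∣ Polynomial.derivative (leepPhi M f) := by
      rw [leepPhi_derivative]
      exact Finset.dvd_sum fun j _ => (h1 j).mul_left _
    rw [Polynomial.X_pow_dvd_iff] at h2 ⊢
    intro e he
    rcases e with _ | e
    · rw [leepPhi_coeff_zero]
      have := hf [] (by simp)
      simp only [iteratedPDeriv, List.foldl_nil] at this
      rw [this, map_zero]
    · have := h2 e (by omega)
      rw [Polynomial.coeff_derivative] at this
      rcases mul_eq_zero.1 this with h | h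
      · exact h
      · exfalso
        have h3 : ((e + 1 : ℕ) : Polynomial ℝ) = 0 := by exact_mod_cast h
        exact Nat.succ_ne_zero e (Nat.cast_eq_zero.1 h3)

lemma leep_sq_dvd {r : ℕ} (m : ℕ) (q : Fin r → Polynomial (Polynomial ℝ))
    (h : Polynomial.X ^ (2 * m) ∣ ∑ i, q i ^ 2) : ∀ i, Polynomial.X ^ m ∣ q i := by
  induction m with
  | zero => intro i; simp
  | succ m ih =>
    have h1 := ih (dvd_trans (pow_dvd_pow _ (by omega)) h)
    choose g hg using h1
    have h2 : ∑ i, q i ^ 2 = Polynomial.X ^ (2 * m) * ∑ i, g i ^ 2 := by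
      rw [Finset.mul_sum]
      apply Finset.sum_congr rfl
      intro i _
      rw [hg i]; ring
    rw [h2, show 2 * (m + 1) = 2 * m + 2 by ring, pow_add] at h
    have h3 : Polynomial.X ^ 2 ∣ ∑ i, g i ^ 2 :=
      (mul_dvd_mul_iff_left (pow_ne_zero _ Polynomial.X_ne_zero)).1 h
    have h4 := Polynomial.X_pow_dvd_iff.1 h3 0 (by norm_num)
    rw [Polynomial.finsetSum_coeff] at h4
    have h5 := sum_sq_zero Finset.univ (fun i => (g i).coeff 0) (by
      rw [← h4]
      apply Finset.sum_congr rfl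
      intro i _
      rw [sq, Polynomial.mul_coeff_zero])
    intro i
    rw [hg i, pow_succ]
    apply mul_dvd_mul_left
    rw [Polynomial.X_dvd_iff]
    exact h5 i (Finset.mem_univ i)

/-- The linear forms dual to the columns of `M`. -/
def leepL (N : Matrix (Fin 3) (Fin 3) ℝ) (k : Fin 3) : MvPolynomial (Fin 3) ℝ :=
  ∑ j, MvPolynomial.C (N k j) * MvPolynomial.X j

lemma leepL_hom (N : Matrix (Fin 3) (Fin 3) ℝ) (k : Fin 3) : (leepL N k).IsHomogeneous 1 := by
  apply MvPolynomial.IsHomogeneous.sum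
  intro j _
  simpa using (MvPolynomial.isHomogeneous_C (Fin 3) (N k j)).mul (MvPolynomial.isHomogeneous_X ℝ j)

lemma leepPhi_L (M N : Matrix (Fin 3) (Fin 3) ℝ) (h : N * M = 1) (k : Fin 3) :
    leepPhi M (leepL N k) = leepW k := by
  have h1 : ∀ l, ∑ j, N k j * M j l = if k = l then 1 else 0 := by
    intro l
    rw [← Matrix.mul_apply, h, Matrix.one_apply]
  simp only [leepL, map_sum, map_mul, leepPhi_C, leepPhi_X, leepV, Finset.mul_sum]
  rw [Finset.sum_comm]
  have h2 : ∀ l, ∑ j, Polynomial.C (Polynomial.C (N k j)) *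
      (Polynomial.C (Polynomial.C (M j l)) * leepW l) =
      Polynomial.C (Polynomial.C (∑ j, N k j * M j l)) * leepW l := by
    intro l
    simp only [map_sum, map_mul, Finset.sum_mul, mul_assoc]
  simp only [h2, h1]
  rw [Finset.sum_eq_single k]
  · simp
  · intro b _ hb; simp [Ne.symm hb]
  · simp

lemma hom_eval_smul {d : ℕ} {f : MvPolynomial (Fin 3) ℝ} (hf : f.IsHomogeneous d) (c : ℝ)
    (v : Fin 3 → ℝ) : MvPolynomial.eval (fun j => c * v j) f = c ^ d * MvPolynomial.eval v f := by
  rw [MvPolynomial.eval_eq', MvPolynomial.eval_eq', Finset.mul_sum]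
  apply Finset.sum_congr rfl
  intro e he
  have hd : e 0 + e 1 + e 2 = d := by
    have := hf (MvPolynomial.mem_support_iff.1 he)
    rw [← this, Finsupp.weight_apply, Finsupp.sum_fintype _ _ (by simp)]
    simp [Fin.sum_univ_three]
  rw [Fin.prod_univ_three, Fin.prod_univ_three, ← hd]
  ring

lemma leepPhi_eval (M : Matrix (Fin 3) (Fin 3) ℝ) (f : MvPolynomial (Fin 3) ℝ) (s t : ℝ) :
    ((leepPhi M f).eval (Polynomial.C s)).eval t =
      MvPolynomial.eval (fun j => M j 0 + s * (M j 1 * t + M j 2)) f := by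
  induction f using MvPolynomial.induction_on with
  | C a => simp [leepPhi_C]
  | add p q hp hq => simp [hp, hq]
  | mul_X p n hp =>
    rw [map_mul, leepPhi_X, Polynomial.eval_mul, Polynomial.eval_mul, hp, leepV_eq]
    simp

lemma leepPhi_inj (M N : Matrix (Fin 3) (Fin 3) ℝ) (h : N * M = 1) {d : ℕ}
    {f : MvPolynomial (Fin 3) ℝ} (hf : f.IsHomogeneous d) (h0 : leepPhi M f = 0) : f = 0 := by
  have hMN : M * N = 1 := mul_eq_one_comm.1 h
  have hL0 : leepL N 0 ≠ 0 := by
    intro h1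
    have := leepPhi_L M N h 0
    rw [h1] at this
    simp [leepW] at this
  have hL2 : leepL N 2 ≠ 0 := by
    intro h1
    have := leepPhi_L M N h 2
    rw [h1] at this
    simp [leepW] at this
    exact Polynomial.X_ne_zero this.symm
  have key : f * (leepL N 0 * leepL N 2) = 0 := by
    apply MvPolynomial.funext
    intro v
    have hc : ∀ k, MvPolynomial.eval v (leepL N k) = (N.mulVec v) k := by
      intro k
      simp [leepL, Matrix.mulVec, dotProduct]
    rw [map_mul, map_mul, hc, hc, map_zero]
    obtain ⟨c, hcc⟩ : ∃ c, c = N.mulVec v := ⟨_, rfl⟩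
    rw [← hcc]
    by_cases h1 : c 0 = 0
    · simp [h1]
    by_cases h2 : c 2 = 0
    · simp [h2]
    have hv : v = fun j => c 0 * (M j 0 + (c 2 / c 0) * (M j 1 * (c 1 / c 2) + M j 2)) := by
      have h3 : M.mulVec c = v := by rw [hcc, Matrix.mulVec_mulVec, hMN, Matrix.one_mulVec]
      rw [← h3]
      ext j
      simp only [Matrix.mulVec, dotProduct, Fin.sum_univ_three]
      field_simp
      ring
    rw [hv, hom_eval_smul hf, ← leepPhi_eval, h0]
    simp
  rcases mul_eq_zero.1 key with h1 | h1
  · exact h1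
  · exact absurd h1 (mul_ne_zero hL0 hL2)

/-- Homogenization of `β(t) s^j` to a form of degree `d`. -/
def leepBack (N : Matrix (Fin 3) (Fin 3) ℝ) (d j : ℕ) (β : Polynomial ℝ) :
    MvPolynomial (Fin 3) ℝ :=
  leepL N 0 ^ (d - j) * ∑ b ∈ Finset.range (j + 1),
    MvPolynomial.C (β.coeff b) * (leepL N 1 ^ b * leepL N 2 ^ (j - b))

lemma leepBack_hom (N : Matrix (Fin 3) (Fin 3) ℝ) {d j : ℕ} (hj : j ≤ d) (β : Polynomial ℝ) :
    (leepBack N d j β).IsHomogeneous d := by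
  have h1 : (∑ b ∈ Finset.range (j + 1), MvPolynomial.C (β.coeff b) *
      (leepL N 1 ^ b * leepL N 2 ^ (j - b))).IsHomogeneous j := by
    apply MvPolynomial.IsHomogeneous.sum
    intro b hb
    rw [Finset.mem_range] at hb
    have := (MvPolynomial.isHomogeneous_C (Fin 3) (β.coeff b)).mul
      (((leepL_hom N 1).pow b).mul ((leepL_hom N 2).pow (j - b)))
    have h2 : 0 + (1 * b + 1 * (j - b)) = j := by omega
    rwa [h2] at this
  have := ((leepL_hom N 0).pow (d - j)).mul h1
  have h2 : 1 * (d - j) + j = d := by omega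
  rwa [h2] at this

lemma leepPhi_back (M N : Matrix (Fin 3) (Fin 3) ℝ) (h : N * M = 1) (d j : ℕ)
    (β : Polynomial ℝ) (hβ : β.natDegree ≤ j) :
    leepPhi M (leepBack N d j β) = Polynomial.C β * Polynomial.X ^ j := by
  simp only [leepBack, map_mul, map_pow, map_sum, leepPhi_L M N h, leepPhi_C]
  conv_rhs => rw [Polynomial.as_sum_range' β (j + 1) (by omega), map_sum, Finset.sum_mul]
  simp only [leepW, Matrix.cons_val_zero, one_pow, one_mul]
  apply Finset.sum_congr rfl
  intro b hb
  rw [Finset.mem_range] at hb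
  simp only [Matrix.cons_val_one, Matrix.cons_val, ← Polynomial.C_mul_X_pow_eq_monomial, map_mul,
    map_pow, mul_pow]
  have : j = b + (j - b) := by omega
  conv_rhs => rw [this, pow_add]
  ring

lemma leep_gram {r n : ℕ} (B : Matrix (Fin r) (Fin n) (Polynomial ℝ))
    (y : Fin n → Polynomial (Polynomial ℝ)) :
    ∑ l, (∑ J, Polynomial.C (B l J) * y J) ^ 2 =
      ∑ J, ∑ K, Polynomial.C ((B.transpose * B) J K) * (y J * y K) := by
  simp only [sq, Finset.sum_mul_sum]
  simp only [Matrix.mul_apply, map_sum, Finset.sum_mul, Matrix.transpose_apply, map_mul]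
  rw [Finset.sum_comm]
  apply Finset.sum_congr rfl
  intro J _
  rw [Finset.sum_comm]
  apply Finset.sum_congr rfl
  intro K _
  apply Finset.sum_congr rfl
  intro l _
  ring

lemma exists_frame (ξ : Fin 3 → ℝ) (hξ : ξ ≠ 0) :
    ∃ M N : Matrix (Fin 3) (Fin 3) ℝ, N * M = 1 ∧ (fun j => M j 0) = ξ := by
  have he : (Pi.single 0 1 : Fin 3 → ℝ) ≠ 0 := by
    intro h
    have := congrFun h 0
    simp at this
  obtain ⟨A, hA⟩ := SeparatingDual.exists_continuousLinearEquiv_apply_eq (R := ℝ) he hξ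
  refine ⟨LinearMap.toMatrix' (A.toLinearEquiv : (Fin 3 → ℝ) →ₗ[ℝ] (Fin 3 → ℝ)),
    LinearMap.toMatrix' (A.toLinearEquiv.symm : (Fin 3 → ℝ) →ₗ[ℝ] (Fin 3 → ℝ)), ?_, ?_⟩
  · rw [← LinearMap.toMatrix'_comp]
    simp
  · ext j
    rw [← hA]
    simp [LinearMap.toMatrix'_apply]

lemma leep_core (d m : ℕ) (f : MvPolynomial (Fin 3) ℝ) (hf : InSigma 3 d f)
    (ξ : Fin 3 → ℝ) (hξ : ξ ≠ 0)
    (hm : ∀ l : List (Fin 3), l.length < 2 * m → MvPolynomial.eval ξ (iteratedPDeriv l f) = 0) :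
    sosLength 3 d f ≤ d + 2 - m := by
  obtain ⟨M, N, hNM, hM⟩ := exists_frame ξ hξ
  obtain ⟨r, p, hp, hfp⟩ := hf
  have hfh : f.IsHomogeneous (d * 2) := by
    rw [hfp]
    exact MvPolynomial.IsHomogeneous.sum _ _ _ fun i _ => (hp i).pow 2
  have hdvd : Polynomial.X ^ (2 * m) ∣ leepPhi M f := by
    apply leep_vanish
    rw [hM]
    exact hm
  by_cases hmd : d < m
  · have h0 : leepPhi M f = 0 := by
      by_contra hne
      have h1 := Polynomial.natDegree_le_of_dvd hdvd hne
      rw [Polynomial.natDegree_X_pow] at h1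
      have h2 := (leepPhi_good M hfh).1
      omega
    have h1 := leepPhi_inj M N hNM hfh h0
    have h2 : sosLength 3 d f ≤ 0 := Nat.sInf_le ⟨fun _ => 0, fun i => i.elim0, by simp [h1]⟩
    omega
  push Not at hmd
  have hphi : leepPhi M f = ∑ i, (leepPhi M (p i)) ^ 2 := by
    rw [hfp, map_sum]
    simp only [map_pow]
  have hpi := leep_sq_dvd m (fun i => leepPhi M (p i)) (by rw [← hphi]; exact hdvd)
  obtain ⟨A, hA⟩ : ∃ A : Matrix (Fin r) (Fin (d - m + 1)) (Polynomial ℝ),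
    A = Matrix.of fun i (J : Fin (d - m + 1)) => (leepPhi M (p i)).coeff (m + (J : ℕ)) := ⟨_, rfl⟩
  have hpA : ∀ i, leepPhi M (p i) = ∑ J, Polynomial.C (A i J) * Polynomial.X ^ (m + (J : ℕ)) := by
    intro i
    have h1 := Polynomial.as_sum_range' (leepPhi M (p i)) (m + (d - m + 1))
      (by have := (leepPhi_good M (hp i)).1; omega)
    rw [Finset.sum_range_add, Finset.sum_eq_zero, zero_add, Finset.sum_range] at h1
    · simp only [hA, Matrix.of_apply, Polynomial.C_mul_X_pow_eq_monomial]
      exact h1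
    · intro j hj
      rw [Polynomial.X_pow_dvd_iff.1 (hpi i) j (Finset.mem_range.1 hj)]
      simp
  obtain ⟨B, hB⟩ := gram_main A
  have hBdeg : ∀ l J, (B l J).natDegree ≤ m + (J : ℕ) := by
    intro l J
    have h1 := congrFun (congrFun hB J) J
    simp only [Matrix.mul_apply, Matrix.transpose_apply] at h1
    have h2 : (∑ i, A i J * A i J).natDegree ≤ 2 * (m + J) := by
      apply Polynomial.natDegree_sum_le_of_forall_le
      intro i _
      have h3 : (A i J).natDegree ≤ m + J := by
        rw [hA]; exact (leepPhi_good M (hp i)).2 _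
      refine Polynomial.natDegree_mul_le.trans ?_
      omega
    have h3 : PolyNonneg ((∑ i, A i J * A i J) - B l J ^ 2) := by
      rw [h1]
      intro t
      rw [Polynomial.eval_sub, Polynomial.eval_finsetSum, Polynomial.eval_pow, sub_nonneg]
      have := Finset.single_le_sum (f := fun l => (B l J * B l J).eval t) (fun i _ => by
        simp only [Polynomial.eval_mul]; exact mul_self_nonneg _) (Finset.mem_univ l)
      simpa [sq] using this
    have h4 := h3.degree_le
    omega
  have hsos : IsSOS 3 d (d - m + 1 + 1) f := by
    refine ⟨fun l => ∑ J : Fin (d - m + 1), leepBack N d (m + (J : ℕ)) (B l J), ?_, ?_⟩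
    · intro l
      apply MvPolynomial.IsHomogeneous.sum
      intro J _
      exact leepBack_hom N (by have := J.2; omega) _
    · rw [← sub_eq_zero]
      refine leepPhi_inj M N hNM (d := d * 2) (hfh.sub ?_) ?_
      · apply MvPolynomial.IsHomogeneous.sum
        intro l _
        apply MvPolynomial.IsHomogeneous.pow
        apply MvPolynomial.IsHomogeneous.sum
        intro J _
        exact leepBack_hom N (by have := J.2; omega) _
      · rw [map_sub, sub_eq_zero, hphi, map_sum]
        simp only [map_pow, map_sum, leepPhi_back M N hNM d _ _ (hBdeg _ _), hpA]
        rw [leep_gram, leep_gram, hB]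
  have h2 : sosLength 3 d f ≤ d - m + 1 + 1 := Nat.sInf_le hsos
  omega

end

open MvPolynomial

/-- Leep's bound for ternary forms: if `f ∈ Σ_{3,2d}` has a real zero of
multiplicity `≥ 2m`, then `ℓ(f) ≤ d + 2 - m`; in particular `p(3,2d) ≤ d + 2`. -/
theorem leep_bound_ternary (d : ℕ) (hd : 1 ≤ d) :
    (∀ (m : ℕ) (f : MvPolynomial (Fin 3) ℝ), InSigma 3 d f →
      ∀ ξ : Fin 3 → ℝ, ξ ≠ 0 →
      (∀ l : List (Fin 3), l.length < 2 * m → eval ξ (iteratedPDeriv l f) = 0) →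
      sosLength 3 d f ≤ d + 2 - m) ∧
    (∀ f : MvPolynomial (Fin 3) ℝ, InSigma 3 d f → sosLength 3 d f ≤ d + 2) := by
  refine ⟨fun m f hf ξ hξ hm => leep_core d m f hf ξ hξ hm, fun f hf => ?_⟩
  exact leep_core d 0 f hf 1 one_ne_zero (fun l hl => absurd hl (by simp))
end

section
/- Let n, d, r ≥ 1 and suppose the set Σ_{n,2d}(r) of sums of r squares of degree-d forms has nonempty interior in ℝ[x_1,…,x_n]_{2d}. Then Σ_{n,2d}(r) is equal to the closure of its interior. -/
open MvPolynomial

noncomputable section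

/-- The coefficientwise topology on polynomials; on each finite-dimensional
subspace of forms of fixed degree it induces the standard topology. -/
instance (n : ℕ) : TopologicalSpace (MvPolynomial (Fin n) ℝ) :=
  TopologicalSpace.induced (fun f (m : Fin n →₀ ℕ) => MvPolynomial.coeff m f) inferInstance

namespace SigmaAux

/-- The nonvanishing set of a nonzero polynomial is dense. -/
lemma dense_nonvanishing {σ : Type*} (g : MvPolynomial σ ℝ) (hg : g ≠ 0) :
    Dense {x : σ → ℝ | eval x g ≠ 0} := by
  obtain ⟨q, hq⟩ : ∃ q, eval q g ≠ 0 := by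
    by_contra! hcon
    exact hg (MvPolynomial.funext (fun x => by simpa using hcon x))
  intro p
  let l : σ → Polynomial ℝ := fun i => Polynomial.C (p i) + Polynomial.X * Polynomial.C (q i - p i)
  let P : Polynomial ℝ := aeval l g
  have hP : ∀ t : ℝ, P.eval t = eval (fun i => p i + t * (q i - p i)) g := by
    intro t
    have h1 : (Polynomial.evalRingHom t).comp (aeval l : MvPolynomial σ ℝ →ₐ[ℝ] _).toRingHom
        = eval (fun i => p i + t * (q i - p i)) := by
      apply MvPolynomial.ringHom_ext
      · intro r; simp
      · intro i; simp [l]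
    exact congrArg (fun φ => φ g) h1
  have hP0 : P ≠ 0 := by
    intro h0
    have := hP 1
    simp [h0] at this
    exact hq this.symm
  have hd : Dense {t : ℝ | P.eval t ≠ 0} := by
    have : {t : ℝ | P.eval t ≠ 0} = (P.roots.toFinset : Set ℝ)ᶜ := by
      ext t; simp [hP0]
    rw [this]
    exact Set.Countable.dense_compl ℝ (Finset.countable_toSet _)
  have hc : Continuous (fun t : ℝ => (fun i => p i + t * (q i - p i))) := by fun_prop
  have h0 := hd 0
  have := mem_closure_image (hc.continuousAt (x := 0)) h0
  simp only [zero_mul, add_zero] at this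
  refine closure_mono ?_ this
  rintro _ ⟨t, ht, rfl⟩
  simpa [hP] using ht

lemma hasStrictFDerivAt_eval {σ : Type*} [Fintype σ] (f : MvPolynomial σ ℝ) (x : σ → ℝ) :
    HasStrictFDerivAt (fun y : σ → ℝ => eval y f)
      (∑ j, eval x (pderiv j f) • ContinuousLinearMap.proj (R := ℝ) (φ := fun _ : σ => ℝ) j) x := by
  classical
  induction f using MvPolynomial.induction_on with
  | C a => simpa using hasStrictFDerivAt_const (𝕜 := ℝ) (E := σ → ℝ) a x
  | add p q hp hq =>
    simp only [map_add, add_smul, Finset.sum_add_distrib]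
    exact hp.add hq
  | mul_X p i hp =>
    have h2 : HasStrictFDerivAt (fun y : σ → ℝ => y i)
      (ContinuousLinearMap.proj (R := ℝ) (φ := fun _ : σ => ℝ) i) x := hasStrictFDerivAt_apply i x
    have h3 := hp.mul h2
    simp only [map_mul, eval_X]
    refine h3.congr_fderiv ?_
    ext w
    simp [pderiv_X, add_mul, Finset.sum_add_distrib, Finset.mul_sum, Pi.single_apply, apply_ite,
      Finset.sum_ite_eq]
    ring_nf

lemma algIndep_of_interior {σ τ : Type*} [Fintype σ] [Fintype τ] (f : τ → MvPolynomial σ ℝ)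
    (h : (interior (Set.range (fun (x : σ → ℝ) (k : τ) => eval x (f k)))).Nonempty) :
    AlgebraicIndependent ℝ f := by
  rw [algebraicIndependent_iff]
  intro P hP
  by_contra hne
  obtain ⟨y, hy, hy2⟩ := (dense_nonvanishing P hne).inter_open_nonempty _ isOpen_interior h
  obtain ⟨x, rfl⟩ := interior_subset hy
  apply hy2
  have := congrArg (eval x) hP
  rw [map_zero] at this
  rw [← this]
  have h1 : (eval x).comp (aeval f : MvPolynomial τ ℝ →ₐ[ℝ] _).toRingHom
      = eval (fun k => eval x (f k)) := by
    apply MvPolynomial.ringHom_ext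
    · intro r; simp
    · intro i; simp
  exact (congrArg (fun φ => φ P) h1).symm

lemma derivation_eq_zero {R A K : Type*} [CommRing R] [CommRing A] [Algebra R A]
    [CharZero A] [IsDomain A] [Field K] [Algebra A K] [FaithfulSMul A K] [Algebra R K]
    [IsScalarTower R A K]
    (S : Subalgebra R A) [Algebra.IsAlgebraic S A] (D : Derivation R A K)
    (hD : ∀ a ∈ S, D a = 0) (x : A) : D x = 0 := by
  have key : ∀ P : Polynomial S, D (Polynomial.aeval x P) =
      algebraMap A K (Polynomial.aeval x P.derivative) * D x := by
    intro P
    induction P using Polynomial.induction_on' with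
    | add p q hp hq => simp [hp, hq, add_mul]
    | monomial n a =>
      rw [Polynomial.aeval_monomial, Derivation.leibniz, Derivation.leibniz_pow,
        Polynomial.derivative_monomial, Polynomial.aeval_monomial]
      have : D (algebraMap S A a) = 0 := hD _ a.2
      rw [this]
      simp [Algebra.smul_def]
      ring
  have hex : ∃ n, ∃ P : Polynomial S, P ≠ 0 ∧ Polynomial.aeval x P = 0 ∧ P.natDegree = n := by
    obtain ⟨P, h1, h2⟩ := Algebra.IsAlgebraic.isAlgebraic (R := S) x
    exact ⟨_, P, h1, h2, rfl⟩
  classical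
  obtain ⟨P, h1, h2, h3⟩ := Nat.find_spec hex
  have hdeg : P.natDegree ≠ 0 := by
    intro h0
    rw [Polynomial.eq_C_of_natDegree_eq_zero h0] at h2 h1
    simp at h2 h1
    exact h1 h2
  have hd0 : P.derivative ≠ 0 := by
    intro h0
    exact hdeg (Polynomial.derivative_eq_zero.mp h0)
  have hlt := Polynomial.natDegree_derivative_lt hdeg
  have hne : Polynomial.aeval x P.derivative ≠ 0 := by
    intro h0
    have := Nat.find_min hex (m := P.derivative.natDegree) (by omega)
    exact this ⟨_, hd0, h0, rfl⟩
  have := key P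
  rw [h2, map_zero] at this
  rcases mul_eq_zero.mp this.symm with h | h
  · exact absurd ((FaithfulSMul.algebraMap_eq_zero_iff A K).mp h) hne
  · exact h

lemma mkDerivation_eq_sum {σ K : Type*} [Fintype σ] [Field K] [Algebra (MvPolynomial σ ℝ) K]
    [Algebra ℝ K] [IsScalarTower ℝ (MvPolynomial σ ℝ) K] (w : σ → K) (f : MvPolynomial σ ℝ) :
    mkDerivation ℝ w f = ∑ j, algebraMap _ K (pderiv j f) * w j := by
  classical
  induction f using MvPolynomial.induction_on with
  | C a => simp
  | add p q hp hq => simp [hp, hq, add_mul, Finset.sum_add_distrib]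
  | mul_X p i hp =>
    simp [hp, Algebra.smul_def, pderiv_X, add_mul, Finset.sum_add_distrib, Finset.mul_sum,
      Pi.single_apply, apply_ite, ite_mul]
    refine Finset.sum_congr rfl fun j _ => ?_
    ring

lemma exists_jacobian_inverse {σ τ : Type*} [Fintype σ] [Fintype τ] [DecidableEq τ]
    (f : τ → MvPolynomial σ ℝ) (hf : AlgebraicIndependent ℝ f) :
    ∃ g : MvPolynomial σ ℝ, g ≠ 0 ∧ ∃ W : τ → σ → MvPolynomial σ ℝ,
      ∀ i k, ∑ j, pderiv j (f k) * W i j = if k = i then g else 0 := by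
  let R := MvPolynomial σ ℝ
  let K := FractionRing R
  obtain ⟨B, hB, hBt⟩ := exists_isTranscendenceBasis_superset (R := ℝ)
    (s := Set.range f) (algebraicIndependent_subtype_range hf.injective |>.2 hf)
  have hcard := hBt.lift_cardinalMk_eq (IsTranscendenceBasis.mvPolynomial σ ℝ)
  have : Finite B := by
    rw [← Cardinal.lt_aleph0_iff_finite, ← Cardinal.lift_lt_aleph0, hcard]
    simp
  have := Fintype.ofFinite B
  have hcard' : Fintype.card B = Fintype.card σ := by
    simpa [Cardinal.mk_fintype] using hcard
  let L : (σ → K) →ₗ[K] (B → K) := LinearMap.pi fun b =>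
    ∑ j, algebraMap R K (pderiv j (b : R)) • LinearMap.proj j
  have hL : ∀ w b, L w b = mkDerivation ℝ w (b : R) := by
    intro w b
    rw [mkDerivation_eq_sum]
    simp only [L, LinearMap.pi_apply, LinearMap.sum_apply, LinearMap.smul_apply,
      LinearMap.proj_apply, smul_eq_mul]
    rfl
  have hinj : Function.Injective L := by
    rw [← LinearMap.ker_eq_bot, LinearMap.ker_eq_bot']
    intro w hw
    have := hBt.isAlgebraic
    ext j
    have h0 := derivation_eq_zero (Algebra.adjoin ℝ (Set.range ((↑) : B → R)))
      (mkDerivation ℝ w) ?_ (X j)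
    · simpa using h0
    · intro a ha
      have := Derivation.eqOn_adjoin (D1 := mkDerivation ℝ w) (D2 := 0)
        (s := Set.range ((↑) : B → R)) ?_ ha
      · simpa using this
      · rintro _ ⟨b, rfl⟩
        rw [← hL, hw]; simp
  have hsurj : Function.Surjective L :=
    (LinearMap.injective_iff_surjective_of_finrank_eq_finrank (by simp [hcard'])).mp hinj
  have hw : ∀ i : τ, ∃ w : σ → K, ∀ k, ∑ j, algebraMap R K (pderiv j (f k)) * w j =
      if k = i then 1 else 0 := by
    classical
    intro i
    obtain ⟨w, hw⟩ := hsurj (Pi.single ⟨f i, hB ⟨i, rfl⟩⟩ 1)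
    refine ⟨w, fun k => ?_⟩
    rw [← mkDerivation_eq_sum]
    have := hL w ⟨f k, hB ⟨k, rfl⟩⟩
    rw [← this, hw, Pi.single_apply]
    simp [hf.injective.eq_iff]
  choose w hw using hw
  obtain ⟨b, hb⟩ := IsLocalization.exist_integer_multiples_of_finite (nonZeroDivisors R)
    (fun ij : τ × σ => w ij.1 ij.2)
  choose W hW using hb
  refine ⟨b, nonZeroDivisors.coe_ne_zero b, fun i j => W (i, j), fun i k => ?_⟩
  apply IsFractionRing.injective R K
  have : algebraMap R K b * (∑ j, algebraMap R K (pderiv j (f k)) * w i j) =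
      algebraMap R K b * (if k = i then 1 else 0) := by rw [hw]
  rw [Finset.mul_sum] at this
  rw [map_sum]
  have h2 : ∀ j, algebraMap R K (pderiv j (f k) * W (i, j)) =
      algebraMap R K b * (algebraMap R K (pderiv j (f k)) * w i j) := by
    intro j
    rw [map_mul, hW]
    simp only [Submonoid.smul_def, Algebra.smul_def]
    ring
  refine (Finset.sum_congr rfl fun j _ => h2 j).trans (this.trans ?_)
  split_ifs <;> simp

lemma range_subset {σ τ : Type*} [Fintype σ] [Fintype τ] (f : τ → MvPolynomial σ ℝ)
    (h : (interior (Set.range (fun (x : σ → ℝ) (k : τ) => eval x (f k)))).Nonempty) :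
    Set.range (fun (x : σ → ℝ) (k : τ) => eval x (f k)) ⊆
      closure (interior (Set.range (fun (x : σ → ℝ) (k : τ) => eval x (f k)))) := by
  classical
  obtain ⟨g, hg, W, hW⟩ := exists_jacobian_inverse f (algIndep_of_interior f h)
  set φ := (fun (x : σ → ℝ) (k : τ) => eval x (f k)) with hφ
  have hd : ∀ x, HasStrictFDerivAt φ (ContinuousLinearMap.pi fun k =>
      ∑ j, eval x (pderiv j (f k)) • ContinuousLinearMap.proj (R := ℝ) (φ := fun _ : σ => ℝ) j) x :=
    fun x => hasStrictFDerivAt_pi.2 fun k => hasStrictFDerivAt_eval (f k) x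
  have hint : ∀ x, eval x g ≠ 0 → φ x ∈ interior (Set.range φ) := by
    intro x hx
    rw [mem_interior_iff_mem_nhds, ← (hd x).map_nhds_eq_of_surj]
    · exact Filter.mem_map.2 (Filter.Eventually.of_forall fun y => ⟨y, rfl⟩)
    · rw [LinearMap.range_eq_top]
      intro c
      refine ⟨fun j => ∑ i, (c i / eval x g) * eval x (W i j), ?_⟩
      ext k
      have h1 : ∀ i, ∑ j, eval x (pderiv j (f k)) * eval x (W i j) =
          if k = i then eval x g else 0 := by
        intro i
        have := congrArg (eval x) (hW i k)
        rw [map_sum] at this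
        simp only [map_mul] at this
        rw [this]; split_ifs <;> simp
      have h2 : ∑ j, eval x (pderiv j (f k)) * ∑ i, (c i / eval x g) * eval x (W i j)
          = ∑ i, (c i / eval x g) * ∑ j, eval x (pderiv j (f k)) * eval x (W i j) := by
        simp only [Finset.mul_sum]
        rw [Finset.sum_comm]
        refine Finset.sum_congr rfl fun i _ => Finset.sum_congr rfl fun j _ => by ring
      simp only [h1] at h2
      have h3 : ∑ j, eval x (pderiv j (f k)) * ∑ i, (c i / eval x g) * eval x (W i j) = c k := by
        rw [h2]; simp [hx]
      simpa using h3
  rintro _ ⟨x, rfl⟩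
  have := mem_closure_image (hd x).continuousAt (dense_nonvanishing g hg x)
  refine closure_mono ?_ this
  rintro _ ⟨y, hy, rfl⟩
  exact hint y hy

lemma range_closed {E F : Type*} [NormedAddCommGroup E] [NormedSpace ℝ E] [FiniteDimensional ℝ E]
    [NormedAddCommGroup F] [NormedSpace ℝ F] [FiniteDimensional ℝ F]
    (φ : E → F) (hc : Continuous φ) (hh : ∀ (t : ℝ) x, φ (t • x) = t ^ 2 • φ x)
    (h0 : ∀ x, φ x = 0 → x = 0) : IsClosed (Set.range φ) := by
  have : ProperSpace E := FiniteDimensional.proper ℝ E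
  have : ProperSpace F := FiniteDimensional.proper ℝ F
  have hb : ∃ c > 0, ∀ x, c * ‖x‖ ^ 2 ≤ ‖φ x‖ := by
    rcases subsingleton_or_nontrivial E with hE | hE
    · refine ⟨1, one_pos, fun x => ?_⟩
      rw [Subsingleton.elim x 0]; simp
    obtain ⟨x0, hx0, hmin⟩ := (isCompact_sphere (0 : E) 1).exists_isMinOn
      (NormedSpace.sphere_nonempty.2 zero_le_one) (hc.norm.continuousOn)
    refine ⟨‖φ x0‖, ?_, fun x => ?_⟩
    · rw [gt_iff_lt, norm_pos_iff]
      intro h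
      have := h0 _ h
      simp [this] at hx0
    · by_cases hx : x = 0
      · simp [hx]
      have hxn : ‖x‖ ≠ 0 := norm_ne_zero_iff.2 hx
      have h1 : ‖x‖⁻¹ • x ∈ Metric.sphere (0 : E) 1 := by
        simp [norm_smul, hxn]
      have h2 : ‖φ x0‖ ≤ ‖φ (‖x‖⁻¹ • x)‖ := hmin h1
      rw [hh, norm_smul] at h2
      have h3 : ‖(‖x‖⁻¹ ^ 2 : ℝ)‖ = (‖x‖ ^ 2)⁻¹ := by simp
      rw [h3] at h2
      have hp : 0 < ‖x‖ ^ 2 := by positivity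
      rw [inv_mul_eq_div, le_div_iff₀ hp] at h2
      exact h2
  obtain ⟨c, hc0, hb⟩ := hb
  have hprop : IsProperMap φ := by
    rw [isProperMap_iff_tendsto_cocompact]
    refine ⟨hc, ?_⟩
    rw [← Metric.cobounded_eq_cocompact, ← Metric.cobounded_eq_cocompact,
      ← tendsto_norm_atTop_iff_cobounded]
    refine Filter.tendsto_atTop_mono hb ?_
    exact Filter.Tendsto.const_mul_atTop hc0
      ((Filter.tendsto_pow_atTop two_ne_zero).comp tendsto_norm_cobounded_atTop)
  exact hprop.isClosedMap.isClosed_range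

lemma finite_deg (n d : ℕ) : {m : Fin n →₀ ℕ | m.degree = d}.Finite :=
  (Finsupp.finite_of_degree_le d).subset fun _ hm => le_of_eq hm

/-- Exponent vectors of degree `d`. -/
abbrev Exps (n d : ℕ) := {m : Fin n →₀ ℕ // m.degree = d}

instance (n d : ℕ) : Finite (Exps n d) := (finite_deg n d).to_subtype

instance (n d : ℕ) : Fintype (Exps n d) := Fintype.ofFinite _

/-- The form with given coefficients. -/
def form {A : Type*} [CommSemiring A] (n d : ℕ) (x : Exps n d → A) : MvPolynomial (Fin n) A :=
  ∑ a : Exps n d, monomial a.1 (x a)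

lemma coeff_form {A : Type*} [CommSemiring A] {n d : ℕ} (x : Exps n d → A) (a : Exps n d) :
    coeff a.1 (form n d x) = x a := by
  classical
  simp only [form, coeff_sum, coeff_monomial]
  rw [Finset.sum_eq_single a]
  · simp
  · intro b _ hb
    rw [if_neg (fun h => hb (Subtype.ext h))]
  · simp

lemma form_homogeneous {A : Type*} [CommSemiring A] {n d : ℕ} (x : Exps n d → A) :
    (form n d x).IsHomogeneous d :=
  IsHomogeneous.sum _ _ _ fun a _ => isHomogeneous_monomial _ a.2

lemma ext_of_homogeneous {A : Type*} [CommSemiring A] {n d : ℕ} {p q : MvPolynomial (Fin n) A}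
    (hp : p.IsHomogeneous d) (hq : q.IsHomogeneous d)
    (h : ∀ a : Exps n d, coeff a.1 p = coeff a.1 q) : p = q := by
  ext m
  by_cases hm : m.degree = d
  · exact h ⟨m, hm⟩
  · rw [hp.coeff_eq_zero hm, hq.coeff_eq_zero hm]

lemma form_coeff {A : Type*} [CommSemiring A] {n d : ℕ} {p : MvPolynomial (Fin n) A}
    (hp : p.IsHomogeneous d) : form n d (fun a => coeff a.1 p) = p :=
  ext_of_homogeneous (form_homogeneous _) hp fun a => coeff_form _ a

/-- The coordinate homeomorphism. -/
def coordHomeo (n d : ℕ) : homogeneousSubmodule (Fin n) ℝ d ≃ₜ (Exps n d → ℝ) where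
  toFun f := fun a => coeff a.1 (f : MvPolynomial (Fin n) ℝ)
  invFun x := ⟨form n d x, (mem_homogeneousSubmodule _ _).2 (form_homogeneous x)⟩
  left_inv f := Subtype.ext (form_coeff ((mem_homogeneousSubmodule _ _).1 f.2))
  right_inv x := funext fun a => coeff_form x a
  continuous_toFun := by
    have h1 : Continuous (fun (f : MvPolynomial (Fin n) ℝ) (m : Fin n →₀ ℕ) => coeff m f) :=
      continuous_induced_dom
    exact continuous_pi fun a => (continuous_apply a.1).comp (h1.comp continuous_subtype_val)
  continuous_invFun := by
    refine Continuous.subtype_mk ?_ _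
    refine continuous_induced_rng.2 (continuous_pi fun m => ?_)
    by_cases hm : m.degree = d
    · have : (fun x : Exps n d → ℝ => coeff m (form n d x)) = fun x => x ⟨m, hm⟩ :=
        funext fun x => coeff_form x ⟨m, hm⟩
      simpa [Function.comp_def, this] using continuous_apply _
    · have : (fun x : Exps n d → ℝ => coeff m (form n d x)) = fun x => 0 :=
        funext fun x => (form_homogeneous x).coeff_eq_zero hm
      simpa [Function.comp_def, this] using continuous_const

/-- The universal sum of squares, coefficientwise. -/
def univ (n d r : ℕ) (m : Exps n (2 * d)) : MvPolynomial (Fin r × Exps n d) ℝ :=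
  coeff m.1 (∑ i : Fin r, form n d (fun a => (X (i, a) : MvPolynomial (Fin r × Exps n d) ℝ)) ^ 2)

lemma eval_univ (n d r : ℕ) (m : Exps n (2 * d)) (x : Fin r × Exps n d → ℝ) :
    eval x (univ n d r m) = coeff m.1 (∑ i : Fin r, form n d (fun a => x (i, a)) ^ 2) := by
  rw [univ, ← coeff_map]
  simp [form, map_sum, map_pow, map_monomial]

lemma sos_homogeneous {n d r : ℕ} (p : Fin r → MvPolynomial (Fin n) ℝ)
    (hp : ∀ i, (p i).IsHomogeneous d) : (∑ i, p i ^ 2).IsHomogeneous (2 * d) :=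
  IsHomogeneous.sum _ _ _ fun i _ => by simpa [mul_comm] using (hp i).pow 2

lemma image_eq (n d r : ℕ) :
    coordHomeo n (2 * d) '' {f : homogeneousSubmodule (Fin n) ℝ (2 * d) |
      IsSOS n d r (f : MvPolynomial (Fin n) ℝ)} =
    Set.range (fun (x : Fin r × Exps n d → ℝ) k => eval x (univ n d r k)) := by
  ext y
  constructor
  · rintro ⟨f, ⟨p, hp, hf⟩, rfl⟩
    refine ⟨fun ia => coeff ia.2.1 (p ia.1), funext fun k => ?_⟩
    simp only [eval_univ, form_coeff (hp _)]
    rw [← hf]; rfl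
  · rintro ⟨x, rfl⟩
    refine ⟨⟨∑ i : Fin r, form n d (fun a => x (i, a)) ^ 2, (mem_homogeneousSubmodule _ _).2
      (sos_homogeneous _ fun i => form_homogeneous _)⟩, ⟨_, fun i => form_homogeneous _, rfl⟩, ?_⟩
    funext k
    simp only [eval_univ]; rfl

lemma univ_closed (n d r : ℕ) :
    IsClosed (Set.range (fun (x : Fin r × Exps n d → ℝ) k => eval x (univ n d r k))) := by
  apply range_closed
  · exact continuous_pi fun k => MvPolynomial.continuous_eval _
  · intro t x
    funext k
    have : ∀ i, form n d (fun a => t * x (i, a)) = C t * form n d (fun a => x (i, a)) := by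
      intro i
      simp [form, Finset.mul_sum, C_mul_monomial]
    simp only [eval_univ, Pi.smul_apply, smul_eq_mul]
    simp only [this, mul_pow, ← Finset.mul_sum, ← C_pow, coeff_C_mul]
  · intro x hx
    have h0 : ∑ i : Fin r, form n d (fun a => x (i, a)) ^ 2 = 0 := by
      refine ext_of_homogeneous (d := 2 * d) (sos_homogeneous _ fun i => form_homogeneous _)
        (isHomogeneous_zero _ _ _) fun a => ?_
      rw [← eval_univ, coeff_zero]
      exact congrFun hx a
    funext ia
    have h1 : form n d (fun a => x (ia.1, a)) = 0 := by
      apply MvPolynomial.funext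
      intro z
      have := congrArg (eval z) h0
      simp only [map_sum, map_pow, map_zero] at this
      rw [Finset.sum_eq_zero_iff_of_nonneg (fun i _ => sq_nonneg _)] at this
      simpa using this ia.1 (Finset.mem_univ _)
    have h2 := coeff_form (fun a => x (ia.1, a)) ia.2
    rw [h1] at h2
    simpa using h2.symm

end SigmaAux

/-- If `Σ_{n,2d}(r)` has nonempty interior in `ℝ[x_1,…,x_n]_{2d}`, then it is
the closure of its interior. -/
theorem sigma_r_closure_interior (n d r : ℕ) (hn : 1 ≤ n) (hd : 1 ≤ d) (hr : 1 ≤ r)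
    (h : (interior {f : MvPolynomial.homogeneousSubmodule (Fin n) ℝ (2 * d) |
      IsSOS n d r (f : MvPolynomial (Fin n) ℝ)}).Nonempty) :
    {f : MvPolynomial.homogeneousSubmodule (Fin n) ℝ (2 * d) |
      IsSOS n d r (f : MvPolynomial (Fin n) ℝ)} =
    closure (interior {f : MvPolynomial.homogeneousSubmodule (Fin n) ℝ (2 * d) |
      IsSOS n d r (f : MvPolynomial (Fin n) ℝ)}) := by
  have hi := SigmaAux.image_eq n d r
  set S := {f : MvPolynomial.homogeneousSubmodule (Fin n) ℝ (2 * d) |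
      IsSOS n d r (f : MvPolynomial (Fin n) ℝ)} with hS
  set e := SigmaAux.coordHomeo n (2 * d) with he
  have hcl : IsClosed S := by
    rw [← e.isClosed_image, hi]
    exact SigmaAux.univ_closed n d r
  apply Set.Subset.antisymm
  · have h2 : (interior (e '' S)).Nonempty := by
      rw [← e.image_interior]; exact h.image e
    rw [hi] at h2
    have h3 := SigmaAux.range_subset _ h2
    rw [← hi, ← e.image_interior, ← e.image_closure] at h3
    exact (Set.image_subset_image_iff e.injective).1 h3
  · exact closure_minimal interior_subset hcl
end
end
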